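/- arXiv:2401.05205 — 7 statements merged into one kernel-verified Lean document; each statement's English description precedes it below -/
import Mathlib

section
/- Let k ≥ 2 be an integer and let D be a finite oriented graph with more than (4k−1)|V(D)|/3 arcs. Then D contains an anti-directed path of length at least k+1 or an anti-directed cycle of length at least k+1. -/
/-- An oriented graph on vertex set `V`, given by its arc relation `A`:
no loops and no pair of antiparallel arcs. -/
def IsOriented {V : Type*} (A : V → V → Prop) : Prop :=
  (∀ v, ¬ A v v) ∧ ∀ u v, A u v → ¬ A v u

/-- The out-degree of a vertex. -/
noncomputable def outDeg {V : Type*} (A : V → V → Prop) (v : V) : ℕ :=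
  {u | A v u}.ncard

/-- The in-degree of a vertex. -/
noncomputable def inDeg {V : Type*} (A : V → V → Prop) (v : V) : ℕ :=
  {u | A u v}.ncard

/-- `δ̃⁰(D) ≥ c`: every vertex with positive out-degree has out-degree at least `c`,
and every vertex with positive in-degree has in-degree at least `c`. -/
def PseudoSemiDegreeAtLeast {V : Type*} (A : V → V → Prop) (c : ℚ) : Prop :=
  ∀ v : V, (0 < outDeg A v → c ≤ (outDeg A v : ℚ)) ∧
    (0 < inDeg A v → c ≤ (inDeg A v : ℚ))

/-- `x` lists the `ℓ + 1` (distinct) vertices of an anti-directed path of length `ℓ`: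
consecutive vertices are joined by an arc and adjacent arcs have opposite
orientations, i.e. `x 0 → x 1 ← x 2 → ⋯` or `x 0 ← x 1 → x 2 ← ⋯`. -/
def IsAntipath {V : Type*} (A : V → V → Prop) {ℓ : ℕ} (x : Fin (ℓ + 1) → V) : Prop :=
  Function.Injective x ∧
    ((∀ i : Fin ℓ, if i.val % 2 = 0 then A (x i.castSucc) (x i.succ)
        else A (x i.succ) (x i.castSucc)) ∨
     (∀ i : Fin ℓ, if i.val % 2 = 0 then A (x i.succ) (x i.castSucc)
        else A (x i.castSucc) (x i.succ)))

/-- `D` contains an anti-directed path of length `ℓ`. -/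
def HasAntipath {V : Type*} (A : V → V → Prop) (ℓ : ℕ) : Prop :=
  ∃ x : Fin (ℓ + 1) → V, IsAntipath A x

/-- `u` lists the `ℓ` (distinct) vertices of a cyclic sequence in which every two
cyclically consecutive vertices are joined by an arc and any two adjacent arcs have
opposite orientations: every vertex either dominates both of its cyclic neighbours
or is dominated by both of them. -/
def IsAnticycleSeq {V : Type*} (A : V → V → Prop) {ℓ : ℕ} (u : ZMod ℓ → V) : Prop :=
  Function.Injective u ∧
    ∀ i : ZMod ℓ, (A (u i) (u (i + 1)) ∧ A (u i) (u (i - 1))) ∨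
      (A (u (i + 1)) (u i) ∧ A (u (i - 1)) (u i))

/-- `D` contains an anti-directed cycle of length `ℓ`. -/
def HasAnticycle {V : Type*} (A : V → V → Prop) (ℓ : ℕ) : Prop :=
  3 ≤ ℓ ∧ ∃ u : ZMod ℓ → V, IsAnticycleSeq A u

section SpanningPath

open scoped Classical

variable {W : Type*}

/-- `r` has a path from `x` to `y` whose vertex set is exactly `M`. -/
def IsSpanPath (r : W → W → Prop) (M : Finset W) (x y : W) : Prop :=
  ∃ l : List W, l.IsChain r ∧ l.Nodup ∧ l.toFinset = M ∧ l.head? = some x ∧ l.getLast? = some y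

variable {r : W → W → Prop} {M : Finset W} {x y : W}

theorem isChain_reverse_of_symm (hs : ∀ a b, r a b → r b a) {l : List W} (h : l.IsChain r) :
    l.reverse.IsChain r := by
  rw [List.isChain_reverse]
  exact h.imp fun a b => hs a b

theorem IsSpanPath.symm (hs : ∀ a b, r a b → r b a) (h : IsSpanPath r M x y) :
    IsSpanPath r M y x := by
  obtain ⟨l, hc, hn, hM, hx, hy⟩ := h
  exact ⟨l.reverse, isChain_reverse_of_symm hs hc, by simpa using hn, by simpa using hM,
    by simpa using hy, by simpa using hx⟩

theorem IsSpanPath.left_mem (h : IsSpanPath r M x y) : x ∈ M := by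
  obtain ⟨l, hc, hn, hM, hx, hy⟩ := h
  rw [← hM, List.mem_toFinset]
  exact List.mem_of_head? hx

theorem IsSpanPath.exists_list (h : IsSpanPath r M x y) :
    ∃ l : List W, l.IsChain r ∧ l.Nodup ∧ (∀ m, m ∈ M ↔ m ∈ l) ∧ l.length = M.card ∧
      l.head? = some x ∧ l.getLast? = some y := by
  obtain ⟨l, hc, hn, rfl, hx, hy⟩ := h
  exact ⟨l, hc, hn, fun m => List.mem_toFinset, (List.toFinset_card_of_nodup hn).symm, hx, hy⟩

theorem exists_pred_of_mem {l : List W} {t : W} (hx : l.head? = some x) (ht : t ∈ l)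
    (hne : t ≠ x) : ∃ e p s, l = p ++ e :: t :: s := by
  obtain ⟨p, s, rfl⟩ := List.append_of_mem ht
  rcases List.eq_nil_or_concat p with rfl | ⟨p', e, rfl⟩
  · simp at hx; exact absurd hx hne
  · exact ⟨e, p', s, by simp⟩

theorem succ_unique {l : List W} (hn : l.Nodup) {e t t' : W} {p s p' s' : List W}
    (h : l = p ++ e :: t :: s) (h' : l = p' ++ e :: t' :: s') : t = t' := by
  have h1 : e ∉ p := by
    rw [h] at hn; intro he
    have := (List.nodup_append.1 hn).2.2 e he e (by simp)
    exact this rfl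
  have h2 : e ∉ t :: s := by
    rw [h] at hn
    exact (List.nodup_cons.1 (List.nodup_append.1 hn).2.1).1
  rw [h] at h'
  rw [List.append_cons_inj_of_notMem h1 h2] at h'
  simp at h'
  exact h'.2.1

theorem pred_unique {l : List W} (hn : l.Nodup) {e e' t : W} {p s p' s' : List W}
    (h : l = p ++ e :: t :: s) (h' : l = p' ++ e' :: t :: s') : e = e' := by
  refine succ_unique (l := l.reverse) (by simpa using hn) (e := t) (t := e) (t' := e')
    (p := s.reverse) (s := p.reverse) (p' := s'.reverse) (s' := p'.reverse) ?_ ?_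
  · rw [h]; simp
  · rw [h']; simp

/-- Pósa rotation at the end `x`. -/
theorem IsSpanPath.card_nbrs_le (hs : ∀ a b, r a b → r b a) (hir : ∀ a, ¬ r a a)
    (h : IsSpanPath r M x y) :
    (M.filter fun t => r x t).card ≤ (M.filter fun e => IsSpanPath r M e y).card := by
  obtain ⟨l, hc, hn, hM, hx, hy⟩ := h
  have hp : ∀ t, t ∈ M.filter (fun t => r x t) → ∃ e p s, l = p ++ e :: t :: s := by
    intro t ht
    rw [Finset.mem_filter, ← hM, List.mem_toFinset] at ht
    exact exists_pred_of_mem hx ht.1 (fun h => hir x (h ▸ ht.2))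
  choose! f p s hf using hp
  refine Finset.card_le_card_of_injOn f ?_ ?_
  · intro t ht
    have hl := hf t ht
    have ht' := (Finset.mem_filter.1 ht).2
    refine Finset.mem_filter.2 ⟨?_, (p t ++ [f t]).reverse ++ t :: s t, ?_, ?_, ?_, ?_, ?_⟩
    · rw [← hM, List.mem_toFinset, hl]; simp
    · have hl' : l = (p t ++ [f t]) ++ t :: s t := by rw [hl]; simp
      rw [hl'] at hc hx
      rw [List.isChain_append] at hc ⊢
      refine ⟨isChain_reverse_of_symm hs hc.1, hc.2.1, ?_⟩
      intro a ha b hb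
      rw [List.getLast?_reverse] at ha
      rw [List.head?_append] at hx
      have : a = x := by
        rw [Option.mem_def] at ha
        rw [ha] at hx
        simpa using hx
      simp at hb
      rw [this, ← hb]
      exact ht'
    · rw [hl] at hn
      have : ((p t ++ [f t]).reverse ++ t :: s t).Perm (p t ++ f t :: t :: s t) := by
        have h1 : p t ++ f t :: t :: s t = (p t ++ [f t]) ++ t :: s t := by simp
        rw [h1]
        exact (List.reverse_perm _).append_right _
      exact this.nodup_iff.2 hn
    · rw [← hM, hl]; ext z; simp
    · simp
    · rw [hl] at hy
      simpa [List.getLast?_append, List.getLast?_cons] using hy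
  · intro t ht t' ht' hEq
    have h1 := hf t ht
    have h2 := hf t' ht'
    rw [hEq] at h1
    exact succ_unique hn h1 h2

theorem exists_isSpanPath_of_cycle {l : List W} (hc : l.IsChain r) (hn : l.Nodup)
    (hM : l.toFinset = M) (hclose : ∀ a ∈ l.getLast?, ∀ b ∈ l.head?, r a b) {m : W} (hm : m ∈ M) :
    ∃ y', IsSpanPath r M m y' := by
  rw [← hM, List.mem_toFinset] at hm
  obtain ⟨p, s, rfl⟩ := List.append_of_mem hm
  have hne : (m :: s) ++ p ≠ [] := by simp
  refine ⟨((m :: s) ++ p).getLast hne, (m :: s) ++ p, ?_, ?_, ?_, by simp,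
    List.getLast?_eq_some_getLast hne⟩
  · rw [List.isChain_append] at hc ⊢
    refine ⟨hc.2.1, hc.1, fun a ha b hb => hclose a ?_ b ?_⟩
    · rw [List.getLast?_append, Option.mem_def.1 ha]; rfl
    · rw [List.head?_append, Option.mem_def.1 hb]; rfl
  · exact List.perm_append_comm.nodup_iff.2 hn
  · rw [← hM]; ext z; simp; tauto

/-- If the neighbourhoods of the two ends of a spanning path cross, the path closes up to a
cycle, so that every vertex is an end of a spanning path. -/
theorem IsSpanPath.exists_of_crossing (hs : ∀ a b, r a b → r b a) (hir : ∀ a, ¬ r a a)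
    (h : IsSpanPath r M x y) (C : Finset W) (hCx : ∀ t ∈ M, r x t → t ∈ C)
    (hCy : ∀ e ∈ M, ∀ t ∈ M, r y e → r e t → t ∈ C)
    (hcard : C.card < (M.filter fun t => r x t).card + (M.filter fun e => r y e).card)
    {m : W} (hm : m ∈ M) : ∃ y', IsSpanPath r M m y' := by
  obtain ⟨l, hc, hn, hM, hx, hy⟩ := h
  have hp : ∀ e, e ∈ M.filter (fun e => r y e) → ∃ t p s, l = p ++ e :: t :: s := by
    intro e he
    rw [Finset.mem_filter, ← hM, List.mem_toFinset] at he
    obtain ⟨t, p, s, h⟩ := exists_pred_of_mem (l := l.reverse) (x := y) (t := e)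
      (by simpa using hy) (by simpa using he.1) (fun h => hir y (h ▸ he.2))
    exact ⟨t, s.reverse, p.reverse, by rw [← List.reverse_reverse l, h]; simp⟩
  choose! f p s hf using hp
  have hinj : Set.InjOn f (M.filter fun e => r y e) := by
    intro e he e' he' hEq
    have h1 := hf e he
    have h2 := hf e' he'
    rw [hEq] at h1
    exact pred_unique hn h1 h2
  have hsub : (M.filter fun t => r x t) ∪ (M.filter fun e => r y e).image f ⊆ C := by
    intro t ht
    rw [Finset.mem_union, Finset.mem_image] at ht
    rcases ht with ht | ⟨e, he, rfl⟩
    · exact hCx t (Finset.mem_filter.1 ht).1 (Finset.mem_filter.1 ht).2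
    · have hl := hf e he
      refine hCy e (Finset.mem_filter.1 he).1 (f e) ?_ (Finset.mem_filter.1 he).2 ?_
      · rw [← hM, List.mem_toFinset, hl]; simp
      · rw [hl, List.isChain_append] at hc
        exact (List.isChain_cons_cons.1 hc.2.1).1
  have hnd : ¬ Disjoint (M.filter fun t => r x t) ((M.filter fun e => r y e).image f) := by
    intro hd
    have := Finset.card_le_card hsub
    rw [Finset.card_union_of_disjoint hd, Finset.card_image_of_injOn hinj] at this
    omega
  rw [Finset.not_disjoint_iff] at hnd
  obtain ⟨t, ht, ht'⟩ := hnd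
  obtain ⟨e, he, rfl⟩ := Finset.mem_image.1 ht'
  have hl := hf e he
  have hl' : l = (p e ++ [e]) ++ f e :: s e := by rw [hl]; simp
  have hxt := (Finset.mem_filter.1 ht).2
  have hye := (Finset.mem_filter.1 he).2
  refine exists_isSpanPath_of_cycle (l := (p e ++ [e]) ++ (f e :: s e).reverse) ?_ ?_ ?_ ?_ hm
  · rw [hl'] at hc hy
    rw [List.isChain_append] at hc ⊢
    refine ⟨hc.1, isChain_reverse_of_symm hs hc.2.1, ?_⟩
    intro a ha b hb
    rw [List.head?_reverse, Option.mem_def] at hb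
    rw [List.getLast?_append, hb] at hy
    simp at ha hy
    rw [← ha, hy]
    exact hs _ _ hye
  · rw [hl'] at hn
    exact ((List.reverse_perm (f e :: s e)).append_left (p e ++ [e])).nodup_iff.2 hn
  · rw [← hM, hl]; ext z; simp
  · intro a ha b hb
    rw [List.getLast?_append, List.getLast?_reverse] at ha
    rw [hl', List.head?_append] at hx
    rw [List.head?_append, Option.mem_def] at hb
    have hb' : b = x := by
      rcases hh : (p e ++ [e]).head? with _ | c
      · simp at hh
      · rw [hh] at hx hb; simp at hx hb; rw [← hx, ← hb]
    simp at ha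
    rw [hb', ← ha]
    exact hs _ _ hxt

end SpanningPath

section SplitGraph

open scoped Classical

variable {V : Type*} {A : V → V → Prop}

/-- The bipartite split graph of `A`: the copy `(u, true)` is joined to `(v, false)` for each
arc `u → v`. -/
def splitAdj (A : V → V → Prop) (x y : V × Bool) : Prop :=
  (x.2 = true ∧ y.2 = false ∧ A x.1 y.1) ∨ (x.2 = false ∧ y.2 = true ∧ A y.1 x.1)

/-- The other copy of the same vertex. -/
def twin (x : V × Bool) : V × Bool := (x.1, !x.2)

theorem twin_injective : Function.Injective (twin : V × Bool → V × Bool) := by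
  rintro ⟨a, b⟩ ⟨c, d⟩ h
  simpa [twin] using h

theorem eq_or_eq_twin {x y : V × Bool} (h : x.1 = y.1) : x = y ∨ x = twin y := by
  obtain ⟨a, b⟩ := x
  obtain ⟨c, d⟩ := y
  cases b <;> cases d <;> simp_all [twin]

theorem splitAdj_symm (x y : V × Bool) (h : splitAdj A x y) : splitAdj A y x := by
  unfold splitAdj at *; tauto

theorem splitAdj.snd_eq {x y : V × Bool} (h : splitAdj A x y) : y.2 = !x.2 := by
  rcases h with h | h <;> simp [h]

theorem splitAdj_irrefl (x : V × Bool) : ¬ splitAdj A x x := fun h => by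
  simpa using h.snd_eq

theorem splitAdj.fst_ne (hA : IsOriented A) {x y : V × Bool} (h : splitAdj A x y) :
    x.1 ≠ y.1 := by
  intro he
  rcases h with h | h <;> exact hA.1 _ (he ▸ h.2.2)

theorem splitAdj.not_twin (hA : IsOriented A) {x y : V × Bool} (h : splitAdj A x (twin y)) :
    ¬ splitAdj A y (twin x) := by
  intro h'
  obtain ⟨a, b⟩ := x
  obtain ⟨c, d⟩ := y
  have := hA.2 a c
  have := hA.2 c a
  cases b <;> cases d <;> simp_all [splitAdj, twin]

/-- An antipath of `A`, as a list of vertices tagged with their role (`true` for sources). -/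
def IsAlt (A : V → V → Prop) (l : List (V × Bool)) : Prop :=
  l.IsChain (splitAdj A) ∧ (l.map Prod.fst).Nodup

theorem IsAlt.nodup {l : List (V × Bool)} (h : IsAlt A l) : l.Nodup := List.Nodup.of_map _ h.2

theorem IsAlt.hasAntipath {l : List (V × Bool)} (h : IsAlt A l) {n : ℕ}
    (hl : l.length = n + 1) : HasAntipath A n := by
  have hch := List.isChain_iff_getElem.1 h.1
  have hpar : ∀ i (hi : i < l.length),
      (l[i]).2 = if i % 2 = 0 then (l[0]'(by omega)).2 else !(l[0]'(by omega)).2 := by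
    intro i
    induction i with
    | zero => intro hi; simp
    | succ i ih =>
      intro hi
      have h1 := (hch i hi).snd_eq
      rw [h1, ih (by omega)]
      by_cases h2 : i % 2 = 0
      · have : (i + 1) % 2 ≠ 0 := by omega
        simp [h2, this]
      · have : (i + 1) % 2 = 0 := by omega
        simp [h2, this]
  refine ⟨fun i => (l[i.val]'(by omega)).1, ?_, ?_⟩
  · intro i j hij
    have := (List.Nodup.getElem_inj_iff h.2 (i := i.val) (j := j.val)
      (hi := by simp; omega) (hj := by simp; omega)).1 (by simpa using hij)
    exact Fin.ext this
  · rcases hb : (l[0]'(by omega)).2 with _ | _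
    · right
      intro i
      have h1 := hch i.val (by omega)
      have h2 := hpar i.val (by omega)
      rw [hb] at h2
      unfold splitAdj at h1
      split_ifs with h3 <;> simp [h3] at h2 <;> simp [h2] at h1 <;> exact h1.2
    · left
      intro i
      have h1 := hch i.val (by omega)
      have h2 := hpar i.val (by omega)
      rw [hb] at h2
      unfold splitAdj at h1
      split_ifs with h3 <;> simp [h3] at h2 <;> simp [h2] at h1 <;> exact h1.2

theorem countP_of_isChain {l : List (V × Bool)} {x y : V × Bool} (hc : l.IsChain (splitAdj A))
    (hx : l.head? = some x) (hy : l.getLast? = some y) :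
    l.countP (fun m => m.2 = x.2) =
      l.countP (fun m => m.2 = !x.2) + if x.2 = y.2 then 1 else 0 := by
  induction l generalizing x with
  | nil => simp at hx
  | cons a l ih =>
    simp at hx
    subst hx
    cases l with
    | nil => simp at hy; simp [hy]
    | cons b l =>
      rw [List.isChain_cons_cons] at hc
      have h1 := ih hc.2 (x := b) rfl (by simpa [List.getLast?_cons] using hy)
      have h2 := hc.1.snd_eq
      rw [h2] at h1
      simp only [Bool.not_not] at h1
      rw [List.countP_cons, List.countP_cons (a := a), h1]
      rcases ha : a.2 <;> rcases hyy : y.2 <;> simp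

theorem card_filter_toFinset {α : Type*} {l : List α} (hn : l.Nodup)
    (p : α → Prop) [DecidablePred p] :
    (l.toFinset.filter p).card = l.countP (fun m => p m) := by
  rw [List.countP_eq_length_filter, ← List.toFinset_card_of_nodup (hn.filter _)]
  congr 1
  ext m
  simp

theorem IsSpanPath.card_filter_snd {M : Finset (V × Bool)} {x y : V × Bool}
    (h : IsSpanPath (splitAdj A) M x y) :
    (M.filter fun m => m.2 = x.2).card =
      (M.filter fun m => m.2 = !x.2).card + if x.2 = y.2 then 1 else 0 := by
  obtain ⟨l, hc, hn, rfl, hx, hy⟩ := h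
  rw [card_filter_toFinset hn, card_filter_toFinset hn]
  exact countP_of_isChain hc hx hy

theorem card_filter_snd_add (M : Finset (V × Bool)) (b : Bool) :
    (M.filter fun m => m.2 = b).card + (M.filter fun m => m.2 = !b).card = M.card := by
  rw [← Finset.card_filter_add_card_filter_not (s := M) (fun m => m.2 = b)]
  congr 2
  ext m
  cases b <;> simp

variable [Fintype V]

/-- The number of arcs of `A` that correspond to edges of the split graph meeting `Y`. -/
noncomputable def incArcs (A : V → V → Prop) (Y : Finset (V × Bool)) : ℕ :=
  (Finset.univ.filter fun p : V × V => A p.1 p.2 ∧ ((p.1, true) ∈ Y ∨ (p.2, false) ∈ Y)).card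

/-- Every nonempty set `Y` of non-isolated vertices of the split graph meets more than
`(4 * k - 1) * |Y| / 6` edges. -/
def LocallyDense (A : V → V → Prop) (k : ℕ) : Prop :=
  ∀ Y : Finset (V × Bool), Y.Nonempty → (∀ y ∈ Y, ∃ t, splitAdj A y t) →
    4 * k * Y.card < 6 * incArcs A Y + Y.card

theorem exists_locallyDense {k : ℕ} (hk : 1 ≤ k)
    (h : 4 * k * (2 * Fintype.card V) <
      6 * (Finset.univ.filter fun p : V × V => A p.1 p.2).card + 2 * Fintype.card V) :
    ∃ B : V → V → Prop, (∀ u v, B u v → A u v) ∧ (∃ u v, B u v) ∧ LocallyDense B k := by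
  let R : Finset (V × Bool) → V × V → Prop := fun S p =>
    A p.1 p.2 ∧ (p.1, true) ∈ S ∧ (p.2, false) ∈ S
  let e : Finset (V × Bool) → ℕ := fun S => (Finset.univ.filter (R S)).card
  let D : Set (Finset (V × Bool)) := {S | 4 * k * S.card < 6 * e S + S.card}
  have hne : D.Nonempty := by
    refine ⟨Finset.univ, ?_⟩
    simp only [D, e, R, Set.mem_ofPred_eq, Finset.card_univ, Fintype.card_prod, Fintype.card_bool,
      Finset.mem_univ, and_true]
    rw [mul_comm (Fintype.card V) 2]
    exact h
  obtain ⟨S, hS, hmin⟩ := WellFounded.has_min (wellFounded_lt (α := Finset (V × Bool))) D hne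
  refine ⟨fun u v => R S (u, v), fun u v h => h.1, ?_, ?_⟩
  · by_contra hno
    push Not at hno
    have h0 : e S = 0 := by
      simp only [e, Finset.card_eq_zero, Finset.filter_eq_empty_iff]
      exact fun p _ => hno p.1 p.2
    simp only [D, Set.mem_ofPred_eq, h0] at hS
    nlinarith
  · intro Y hY hYadj
    have hYS : Y ⊆ S := by
      intro y hy
      obtain ⟨t, ht⟩ := hYadj y hy
      obtain ⟨a, b⟩ := y
      rcases ht with ht | ht
      · obtain ⟨h1, h2, h3⟩ := ht
        simp only at h1; subst h1; exact h3.2.1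
      · obtain ⟨h1, h2, h3⟩ := ht
        simp only at h1; subst h1; exact h3.2.2
    have hlt : S \ Y < S := by
      refine Finset.ssubset_iff_subset_ne.2 ⟨Finset.sdiff_subset, fun h => ?_⟩
      obtain ⟨y, hy⟩ := hY
      have := h.symm ▸ hYS hy
      simp [hy] at this
    have h1 := fun hh => hmin (S \ Y) hh hlt
    simp only [D, Set.mem_ofPred_eq] at h1 hS
    have h2 : e S = incArcs (fun u v => R S (u, v)) Y + e (S \ Y) := by
      simp only [e, incArcs]
      rw [← Finset.card_union_of_disjoint]
      · congr 1
        ext p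
        simp only [R, Finset.mem_filter, Finset.mem_univ, true_and, Finset.mem_union,
          Finset.mem_sdiff]
        tauto
      · rw [Finset.disjoint_left]
        intro p
        simp only [R, Finset.mem_filter, Finset.mem_univ, true_and, Finset.mem_sdiff]
        tauto
    have h3 : (S \ Y).card + Y.card = S.card := Finset.card_sdiff_add_card_eq_card hYS
    rw [h2, ← h3, mul_add] at hS
    have := Nat.le_of_not_lt h1
    omega

theorem incArcs_singleton (x : V × Bool) :
    incArcs A {x} = (Finset.univ.filter fun t => splitAdj A x t).card := by
  obtain ⟨v, b⟩ := x
  unfold incArcs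
  cases b
  · refine Finset.card_bij (fun p _ => (p.1, true)) ?_ ?_ ?_
    · rintro ⟨a, c⟩ h
      simp [splitAdj] at h ⊢
      exact h.2 ▸ h.1
    · rintro ⟨a, c⟩ h ⟨a', c'⟩ h' he
      simp at h h' he
      simp [he, h.2, h'.2]
    · rintro ⟨a, c⟩ h
      simp [splitAdj] at h ⊢
      simp [h]
  · refine Finset.card_bij (fun p _ => (p.2, false)) ?_ ?_ ?_
    · rintro ⟨a, c⟩ h
      simp [splitAdj] at h ⊢
      exact h.2 ▸ h.1
    · rintro ⟨a, c⟩ h ⟨a', c'⟩ h' he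
      simp at h h' he
      simp [he, h.2, h'.2]
    · rintro ⟨a, c⟩ h
      simp [splitAdj] at h ⊢
      simp [h]

theorem LocallyDense.le_degree {k : ℕ} (hD : LocallyDense A k) {x t : V × Bool}
    (h : splitAdj A x t) : 2 * k ≤ 3 * (Finset.univ.filter fun t => splitAdj A x t).card := by
  have := hD {x} (by simp) (fun y hy => ⟨t, Finset.mem_singleton.1 hy ▸ h⟩)
  rw [incArcs_singleton, Finset.card_singleton] at this
  omega

/-- Arcs meeting `Y` that stay inside `P` are counted by the pairs of `P` meeting `Y`. -/
theorem two_mul_incArcs_le (hA : IsOriented A) {P : Finset V} {Y : Finset (V × Bool)}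
    (hYP : Y.image Prod.fst ⊆ P) (hclosed : ∀ y ∈ Y, ∀ t, splitAdj A y t → t.1 ∈ P) :
    2 * incArcs A Y + (P \ Y.image Prod.fst).offDiag.card ≤ P.offDiag.card := by
  set F := Finset.univ.filter fun p : V × V =>
    A p.1 p.2 ∧ ((p.1, true) ∈ Y ∨ (p.2, false) ∈ Y) with hF
  set U := Y.image Prod.fst with hU
  have hmem : ∀ p ∈ F, p.1 ∈ P ∧ p.2 ∈ P ∧ (p.1 ∈ U ∨ p.2 ∈ U) := by
    rintro ⟨a, b⟩ hp
    simp only [hF, Finset.mem_filter, Finset.mem_univ, true_and] at hp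
    rcases hp.2 with h | h
    · have haU : a ∈ U := Finset.mem_image.2 ⟨_, h, rfl⟩
      exact ⟨hYP haU, hclosed _ h (b, false) (Or.inl ⟨rfl, rfl, hp.1⟩), Or.inl haU⟩
    · have hbU : b ∈ U := Finset.mem_image.2 ⟨_, h, rfl⟩
      exact ⟨hclosed _ h (a, true) (Or.inr ⟨rfl, rfl, hp.1⟩), hYP hbU, Or.inr hbU⟩
  have hFA : ∀ p ∈ F, A p.1 p.2 := fun p hp => (Finset.mem_filter.1 hp).2.1
  have hne : ∀ p ∈ F, p.1 ≠ p.2 := fun p hp he => hA.1 p.1 (by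
    have := hFA p hp; rwa [← he] at this)
  have hd1 : Disjoint F (F.image Prod.swap) := by
    rw [Finset.disjoint_left]
    intro p hp hp'
    obtain ⟨p', h1, rfl⟩ := Finset.mem_image.1 hp'
    exact hA.2 _ _ (hFA _ hp) (hFA _ h1)
  have hd2 : Disjoint (F ∪ F.image Prod.swap) (P \ U).offDiag := by
    rw [Finset.disjoint_left]
    intro p hp hp'
    rw [Finset.mem_offDiag, Finset.mem_sdiff, Finset.mem_sdiff] at hp'
    rcases Finset.mem_union.1 hp with h | h
    · have := hmem p h; tauto
    · obtain ⟨p', h1, rfl⟩ := Finset.mem_image.1 h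
      have := hmem p' h1
      simp only [Prod.fst_swap, Prod.snd_swap] at hp'
      tauto
  have hsub : (F ∪ F.image Prod.swap) ∪ (P \ U).offDiag ⊆ P.offDiag := by
    intro p hp
    rw [Finset.mem_offDiag]
    rcases Finset.mem_union.1 hp with h | h
    · rcases Finset.mem_union.1 h with h | h
      · exact ⟨(hmem p h).1, (hmem p h).2.1, hne p h⟩
      · obtain ⟨p', h1, rfl⟩ := Finset.mem_image.1 h
        exact ⟨(hmem p' h1).2.1, (hmem p' h1).1, (hne p' h1).symm⟩
    · rw [Finset.mem_offDiag, Finset.mem_sdiff, Finset.mem_sdiff] at h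
      exact ⟨h.1.1, h.2.1.1, h.2.2⟩
  have := Finset.card_le_card hsub
  rw [Finset.card_union_of_disjoint hd2, Finset.card_union_of_disjoint hd1,
    Finset.card_image_of_injective _ Prod.swap_injective] at this
  have h3 : incArcs A Y = F.card := rfl
  omega

end SplitGraph

section LongestAntipath

open scoped Classical

theorem two_mul_sum_card_filter_le {α : Type*} {r : α → α → Prop}
    (hr : ∀ a b, r a b → ¬ r b a) (S : Finset α) :
    2 * ∑ u ∈ S, (S.filter fun m => r u m).card ≤ S.card * (S.card - 1) := by
  have h1 : ∑ u ∈ S, (S.filter fun m => r u m).card =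
      ∑ u ∈ S, (S.filter fun m => r m u).card := by
    simp only [Finset.card_filter]
    exact Finset.sum_comm
  rw [two_mul]
  nth_rewrite 2 [h1]
  rw [← Finset.sum_add_distrib, ← smul_eq_mul]
  refine Finset.sum_le_card_nsmul _ _ _ fun u hu => ?_
  rw [← Finset.card_union_of_disjoint, ← Finset.card_erase_of_mem hu]
  · refine Finset.card_le_card fun m hm => ?_
    rw [Finset.mem_union, Finset.mem_filter, Finset.mem_filter] at hm
    rw [Finset.mem_erase]
    have := hr u u
    refine ⟨?_, by tauto⟩
    rintro rfl
    tauto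
  · rw [Finset.disjoint_left]
    intro m hm hm'
    exact hr _ _ (Finset.mem_filter.1 hm).2 (Finset.mem_filter.1 hm').2

theorem exists_card_filter_le {α : Type*} {r : α → α → Prop}
    (hr : ∀ a b, r a b → ¬ r b a) {S C : Finset α} (hSC : S ⊆ C) (hS : S.Nonempty) :
    ∃ u ∈ S, 2 * (C.filter fun m => r u m).card + S.card + 1 ≤ 2 * C.card := by
  by_contra! hno
  have h1 := two_mul_sum_card_filter_le hr S
  have hC := Finset.card_sdiff_add_card_eq_card hSC
  have h2 : ∀ u ∈ S, 2 * (C \ S).card + S.card ≤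
      2 * (S.filter fun m => r u m).card + 2 * (C \ S).card := by
    intro u hu
    have h3 := hno u hu
    have h4 : (C.filter fun m => r u m).card ≤
        (S.filter fun m => r u m).card + (C \ S).card := by
      refine (Finset.card_le_card ?_).trans (Finset.card_union_le _ _)
      intro m hm
      simp only [Finset.mem_union, Finset.mem_filter, Finset.mem_sdiff] at hm ⊢
      tauto
    omega
  have h3 := Finset.sum_le_sum h2
  rw [Finset.sum_const, Finset.sum_add_distrib, Finset.sum_const, ← Finset.mul_sum, smul_eq_mul,
    smul_eq_mul] at h3
  have hpos := hS.card_pos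
  obtain ⟨n, hn⟩ : ∃ n, S.card = n + 1 := ⟨S.card - 1, by omega⟩
  rw [hn] at h1 h3
  simp only [Nat.add_sub_cancel] at h1
  nlinarith

variable {V : Type*} {A : V → V → Prop} {M : Finset (V × Bool)} {x y : V × Bool}

theorem IsSpanPath.ne_of_two_le {W : Type*} {r : W → W → Prop} {M : Finset W} {x y : W}
    (h : IsSpanPath r M x y) (hM : 2 ≤ M.card) : x ≠ y := by
  obtain ⟨l, hc, hn, rfl, hx, hy⟩ := h
  rintro rfl
  rw [List.toFinset_card_of_nodup hn] at hM
  match l with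
  | [] => simp at hM
  | [a] => simp at hM
  | a :: b :: l =>
    simp at hx
    subst hx
    rw [List.getLast?_cons_cons] at hy
    exact (List.nodup_cons.1 hn).1 (List.mem_of_getLast? hy)

theorem IsSpanPath.exists_adj {W : Type*} {r : W → W → Prop} {M : Finset W} {x y : W}
    (h : IsSpanPath r M x y) (hM : 2 ≤ M.card) : ∃ t, r x t := by
  obtain ⟨l, hc, hn, rfl, hx, hy⟩ := h
  rw [List.toFinset_card_of_nodup hn] at hM
  match l with
  | [] => simp at hM
  | [a] => simp at hM
  | a :: b :: l =>
    simp at hx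
    subst hx
    exact ⟨b, (List.isChain_cons_cons.1 hc).1⟩

theorem IsSpanPath.exists_isAlt (h : IsSpanPath (splitAdj A) M x y)
    (hinj : Set.InjOn Prod.fst (M : Set (V × Bool))) :
    ∃ l, IsAlt A l ∧ (∀ m, m ∈ M ↔ m ∈ l) ∧ l.length = M.card ∧ l.head? = some x ∧
      l.getLast? = some y := by
  obtain ⟨l, hc, hn, hm, hlen, hx, hy⟩ := h.exists_list
  exact ⟨l, ⟨hc, hn.map_on fun a ha b hb hab => hinj ((hm a).2 ha) ((hm b).2 hb) hab⟩,
    hm, hlen, hx, hy⟩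

theorem IsAlt.cons {l : List (V × Bool)} (h : IsAlt A l) (hx : l.head? = some x)
    {t : V × Bool} (ht : splitAdj A x t) (hnew : t.1 ∉ l.map Prod.fst) : IsAlt A (t :: l) := by
  refine ⟨?_, ?_⟩
  · rw [List.isChain_cons]
    refine ⟨fun a ha => ?_, h.1⟩
    rw [hx, Option.mem_def, Option.some_inj] at ha
    exact ha ▸ splitAdj_symm _ _ ht
  · rw [List.map_cons, List.nodup_cons]
    exact ⟨hnew, h.2⟩

theorem IsAlt.length_eq_card {l : List (V × Bool)} (h : IsAlt A l) {P : Finset V}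
    (hP : ∀ v, v ∈ P ↔ v ∈ l.map Prod.fst) : l.length = P.card := by
  rw [← List.length_map Prod.fst, ← List.toFinset_card_of_nodup h.2]
  congr 1
  ext v
  rw [hP, List.mem_toFinset]

theorem card_image_fst_add_le {X J : Finset (V × Bool)}
    (hinj : Set.InjOn Prod.fst (J : Set (V × Bool))) (hJ : ∀ e ∈ J, e ∈ X ∧ twin e ∈ X) :
    (X.image Prod.fst).card + J.card ≤ X.card := by
  have h1 := Finset.card_union_add_card_inter ((X.filter fun e => e.2 = true).image Prod.fst)
    ((X.filter fun e => e.2 = !true).image Prod.fst)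
  have h2 : ∀ b, ((X.filter fun e => e.2 = b).image Prod.fst).card =
      (X.filter fun e => e.2 = b).card := by
    intro b
    refine Finset.card_image_of_injOn fun e he e' he' h => ?_
    have h3 := (Finset.mem_filter.1 he).2
    have h4 := (Finset.mem_filter.1 he').2
    exact Prod.ext h (h3.trans h4.symm)
  rw [h2, h2, card_filter_snd_add, ← Finset.image_union] at h1
  have h3 : (X.filter fun e => e.2 = true) ∪ (X.filter fun e => e.2 = !true) = X := by
    ext e
    rw [Finset.mem_union, Finset.mem_filter, Finset.mem_filter]
    cases e.2 <;> simp
  rw [h3] at h1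
  have h4 : (J.image Prod.fst).card ≤ (((X.filter fun e => e.2 = true).image Prod.fst) ∩
      ((X.filter fun e => e.2 = !true).image Prod.fst)).card := by
    refine Finset.card_le_card fun v hv => ?_
    obtain ⟨e, he, rfl⟩ := Finset.mem_image.1 hv
    have := hJ e he
    simp only [Finset.mem_inter, Finset.mem_image, Finset.mem_filter]
    rcases hb : e.2
    · exact ⟨⟨twin e, ⟨this.2, by simp [twin, hb]⟩, rfl⟩, ⟨e, ⟨this.1, by simp [hb]⟩, rfl⟩⟩
    · exact ⟨⟨e, ⟨this.1, by simp [hb]⟩, rfl⟩, ⟨twin e, ⟨this.2, by simp [twin, hb]⟩, rfl⟩⟩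
  rw [Finset.card_image_of_injOn hinj] at h4
  omega

theorem false_of_odd_count {k q t m i I X : ℕ} (h : 4 * k * X < 6 * I + X) (hX : t + i ≤ X)
    (htm : t + m = 2 * q + 1)
    (hI : 2 * I + m * m + (2 * q + 1) ≤ (2 * q + 1) * (2 * q + 1) + m) (hi : q ≤ 3 * i)
    (hq : 1 ≤ q) (hk : 2 * q ≤ k) : False := by
  have h3 : 8 * q * X ≤ 4 * k * X := Nat.mul_le_mul_right X (by omega)
  have h4 : (8 * q - 1) * (t + i) ≤ (8 * q - 1) * X := Nat.mul_le_mul_left _ hX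
  have h5 : (8 * q - 1) * X = 8 * q * X - X := Nat.sub_one_mul _ _
  have h6 : (8 * q - 1) * (t + i) < 6 * I := by
    have := Nat.le_mul_of_pos_left X (show 0 < 8 * q by omega)
    rw [h5] at h4
    exact h4.trans_lt (by omega)
  clear h h3 h4 h5 hX hk
  rcases Nat.lt_or_ge q 3 with hq3 | hq3
  · obtain ⟨n, hn⟩ : ∃ n, n = m * m := ⟨_, rfl⟩
    have : m ≤ 5 := by omega
    rw [← hn] at hI
    interval_cases m <;> interval_cases q <;> omega
  · obtain ⟨p, rfl⟩ : ∃ p, q = p + 3 := ⟨q - 3, by omega⟩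
    have h7 : 8 * (p + 3) - 1 = 8 * p + 23 := by omega
    rw [h7] at h6
    have h8 : (8 * p + 23) * (p + 3) ≤ (8 * p + 23) * (3 * i) := Nat.mul_le_mul_left _ hi
    zify at *
    have hm : (m : ℤ) = 2 * (p + 3) + 1 - t := by linarith
    rw [hm] at hI
    nlinarith [sq_nonneg (3 * (t : ℤ) - 2 * (p + 4))]

theorem false_of_even_count {k q m I X : ℕ} (h : 4 * k * X < 6 * I + X) (hX : 2 * q ≤ X)
    (hI : 2 * I + m * m + 2 * q ≤ 2 * q * (2 * q) + m) (hq : 1 ≤ q) (hk : 2 * q ≤ k + 1) :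
    False := by
  have h3 : 8 * q * X ≤ (4 * k + 4) * X := Nat.mul_le_mul_right X (by omega)
  have h4 : (8 * q - 5) * (2 * q) ≤ (8 * q - 5) * X := Nat.mul_le_mul_left _ hX
  have h5 : (8 * q - 5) * X = 8 * q * X - 5 * X := Nat.sub_mul _ _ _
  have h6 : (8 * q - 5) * (2 * q) < 6 * I := by
    rw [h5] at h4
    rw [add_mul] at h3
    have := Nat.mul_le_mul_right X (show 5 ≤ 8 * q by omega)
    exact h4.trans_lt (by omega)
  have hmm := Nat.le_mul_self m
  obtain ⟨p, rfl⟩ : ∃ p, q = p + 1 := ⟨q - 1, by omega⟩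
  have h7 : 8 * (p + 1) - 5 = 8 * p + 3 := by omega
  rw [h7] at h6
  nlinarith

variable [Fintype V]

/-- The ends, tagged with their role, of the antipaths with vertex set `P`. -/
noncomputable def altEnds (A : V → V → Prop) (P : Finset V) : Finset (V × Bool) :=
  Finset.univ.filter fun x =>
    ∃ l, IsAlt A l ∧ (∀ v, v ∈ P ↔ v ∈ l.map Prod.fst) ∧ l.head? = some x

theorem IsSpanPath.mem_altEnds (h : IsSpanPath (splitAdj A) M x y)
    (hinj : Set.InjOn Prod.fst (M : Set (V × Bool))) : x ∈ altEnds A (M.image Prod.fst) := by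
  obtain ⟨l, hl, hm, -, hx, -⟩ := h.exists_isAlt hinj
  refine Finset.mem_filter.2 ⟨Finset.mem_univ _, l, hl, fun v => ?_, hx⟩
  rw [Finset.mem_image, List.mem_map]
  simp only [hm]

theorem IsSpanPath.twin_mem_altEnds (h : IsSpanPath (splitAdj A) M x y)
    (hinj : Set.InjOn Prod.fst (M : Set (V × Bool))) (hxy : splitAdj A x (twin y))
    (hne : x ≠ y) : twin y ∈ altEnds A (M.image Prod.fst) := by
  obtain ⟨l, hl, hm, -, hx, hy⟩ := h.exists_isAlt hinj
  rcases List.eq_nil_or_concat l with rfl | ⟨p, e, rfl⟩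
  · simp at hx
  have hey : e = y := by simpa using hy
  subst hey
  have hp : p.head? = some x := by
    cases p with
    | nil => simp at hx; exact absurd hx.symm hne
    | cons a p => simpa using hx
  have hl2 := hl.2
  rw [List.concat_eq_append, List.map_append, List.nodup_append] at hl2
  have hp2 : IsAlt A p := by
    refine ⟨?_, hl2.1⟩
    have := hl.1
    rw [List.concat_eq_append, List.isChain_append] at this
    exact this.1
  refine Finset.mem_filter.2 ⟨Finset.mem_univ _, twin e :: p, hp2.cons hp hxy ?_, fun v => ?_, rfl⟩
  · intro hmem
    exact hl2.2.2 _ hmem e.1 (by simp) rfl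
  · rw [Finset.mem_image, List.map_cons, List.mem_cons, List.mem_map]
    simp only [hm, List.concat_eq_append, List.mem_append, List.mem_singleton]
    constructor
    · rintro ⟨a, ha | rfl, rfl⟩
      · exact Or.inr ⟨a, ha, rfl⟩
      · exact Or.inl rfl
    · rintro (rfl | ⟨a, ha, rfl⟩)
      · exact ⟨e, Or.inr rfl, rfl⟩
      · exact ⟨a, Or.inl ha, rfl⟩

theorem adj_fst_mem_of_mem_altEnds {P : Finset V}
    (hmax : ∀ l, IsAlt A l → l.length ≤ P.card) (hx : x ∈ altEnds A P) {t : V × Bool}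
    (ht : splitAdj A x t) : t.1 ∈ P := by
  obtain ⟨l, hl, hP, hh⟩ := (Finset.mem_filter.1 hx).2
  by_contra hno
  have := hmax _ (hl.cons hh ht (by rwa [← hP]))
  rw [List.length_cons, hl.length_eq_card hP] at this
  omega

theorem altEnds_bound (hA : IsOriented A) {k : ℕ} (hD : LocallyDense A k) {P : Finset V}
    (hmax : ∀ l, IsAlt A l → l.length ≤ P.card) (hP : 2 ≤ P.card)
    (hne : (altEnds A P).Nonempty) :
    ∃ t m I : ℕ, t = ((altEnds A P).image Prod.fst).card ∧ t + m = P.card ∧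
      4 * k * (altEnds A P).card < 6 * I + (altEnds A P).card ∧
      2 * I + m * m + P.card ≤ P.card * P.card + m := by
  have hsub : (altEnds A P).image Prod.fst ⊆ P := by
    intro v hv
    obtain ⟨x, hx, rfl⟩ := Finset.mem_image.1 hv
    obtain ⟨l, hl, hP, hh⟩ := (Finset.mem_filter.1 hx).2
    rw [hP]
    exact List.mem_map_of_mem (List.mem_of_head? hh)
  have hcard := Finset.card_sdiff_add_card_eq_card hsub
  have hinc := two_mul_incArcs_le hA hsub
    (fun y hy t ht => adj_fst_mem_of_mem_altEnds hmax hy ht)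
  refine ⟨_, (P \ (altEnds A P).image Prod.fst).card, incArcs A (altEnds A P), rfl, by omega, ?_, ?_⟩
  · refine hD _ hne fun y hy => ?_
    obtain ⟨l, hl, hP', hh⟩ := (Finset.mem_filter.1 hy).2
    have hlen := hl.length_eq_card hP'
    match l with
    | [] => simp at hh
    | [a] => simp at hlen; omega
    | a :: b :: l =>
      simp at hh
      subst hh
      exact ⟨b, (List.isChain_cons_cons.1 hl.1).1⟩
  · rw [Finset.offDiag_card, Finset.offDiag_card] at hinc
    have h1 := Nat.le_mul_self P.card
    have h2 := Nat.le_mul_self (P \ (altEnds A P).image Prod.fst).card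
    omega

theorem IsSpanPath.degree_le (hmax : ∀ l, IsAlt A l → l.length ≤ M.card)
    (hinj : Set.InjOn Prod.fst (M : Set (V × Bool))) (h : IsSpanPath (splitAdj A) M x y) :
    (Finset.univ.filter fun t => splitAdj A x t).card ≤
      (M.filter fun t => splitAdj A x t).card +
        (M.filter fun m => splitAdj A x (twin m)).card := by
  have hP : (M.image Prod.fst).card = M.card := Finset.card_image_of_injOn hinj
  rw [← Finset.card_image_of_injective (M.filter fun m => splitAdj A x (twin m)) twin_injective]
  refine (Finset.card_le_card ?_).trans (Finset.card_union_le _ _)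
  intro t ht
  have ht := (Finset.mem_filter.1 ht).2
  have := adj_fst_mem_of_mem_altEnds (by rwa [hP]) (h.mem_altEnds hinj) ht
  obtain ⟨m, hm, hmt⟩ := Finset.mem_image.1 this
  rw [Finset.mem_union]
  rcases eq_or_eq_twin hmt.symm with rfl | rfl
  · exact Or.inl (Finset.mem_filter.2 ⟨hm, ht⟩)
  · exact Or.inr (Finset.mem_image.2 ⟨m, Finset.mem_filter.2 ⟨hm, ht⟩, rfl⟩)

/-- A longest antipath with an odd number `2 * q + 1 ≤ k + 1` of vertices is impossible. -/
theorem IsSpanPath.false_of_odd (hA : IsOriented A) {k q : ℕ} (hD : LocallyDense A k)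
    (hmax : ∀ l, IsAlt A l → l.length ≤ M.card)
    (hinj : Set.InjOn Prod.fst (M : Set (V × Bool))) (h : IsSpanPath (splitAdj A) M x y)
    (hM : M.card = 2 * q + 1) (hq : 1 ≤ q) (hk : 2 * q ≤ k) : False := by
  have hcl : ∀ a b, IsSpanPath (splitAdj A) M a b →
      a.2 = b.2 ∧ (M.filter fun m => m.2 = a.2).card = q + 1 := by
    intro a b hab
    have h1 := hab.card_filter_snd
    have h2 := card_filter_snd_add M a.2
    split_ifs at h1 with h3 <;> [exact ⟨h3, by omega⟩; omega]
  obtain ⟨⟨u, w⟩, huw, hm⟩ := Finset.exists_max_image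
    (Finset.univ.filter fun p : (V × Bool) × (V × Bool) => IsSpanPath (splitAdj A) M p.1 p.2)
    (fun p => (M.filter fun t => splitAdj A p.1 t).card)
    ⟨(x, y), by simpa using h⟩
  simp only [Finset.mem_filter, Finset.mem_univ, true_and] at huw hm
  have hwu := huw.symm splitAdj_symm
  have hrot := huw.card_nbrs_le splitAdj_symm splitAdj_irrefl
  have hmw := hm (w, u) hwu
  simp only at hmw
  have hdeg := hwu.degree_le hmax hinj
  obtain ⟨t0, ht0⟩ := hwu.exists_adj (by omega)
  have hk3 := hD.le_degree ht0
  set R := M.filter fun e => IsSpanPath (splitAdj A) M e w with hR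
  set T := M.filter fun m => splitAdj A w (twin m) with hT
  have hRT : (R ∪ T).card ≤ q := by
    have : R ∪ T ⊆ (M.filter fun m => m.2 = w.2).erase w := by
      intro e he
      rw [Finset.mem_erase, Finset.mem_filter]
      rcases Finset.mem_union.1 he with he | he
      · obtain ⟨he1, he2⟩ := Finset.mem_filter.1 he
        exact ⟨he2.ne_of_two_le (by omega), he1, (hcl _ _ he2).1⟩
      · obtain ⟨he1, he2⟩ := Finset.mem_filter.1 he
        refine ⟨?_, he1, ?_⟩
        · rintro rfl
          exact he2.fst_ne hA rfl
        · simpa [twin] using he2.snd_eq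
    refine (Finset.card_le_card this).trans ?_
    have hwm : w ∈ M.filter fun m => m.2 = w.2 := Finset.mem_filter.2 ⟨hwu.left_mem, rfl⟩
    rw [Finset.card_erase_of_mem hwm, (hcl _ _ hwu).2]
    simp
  have hui := Finset.card_union_add_card_inter R T
  have hP : (M.image Prod.fst).card = M.card := Finset.card_image_of_injOn hinj
  have hX := card_image_fst_add_le (X := altEnds A (M.image Prod.fst)) (J := R ∩ T)
    (fun a ha b hb => hinj (Finset.mem_filter.1 (Finset.mem_inter.1 ha).1).1
      (Finset.mem_filter.1 (Finset.mem_inter.1 hb).1).1) (by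
      intro e he
      rw [Finset.mem_inter, hR, hT, Finset.mem_filter, Finset.mem_filter] at he
      exact ⟨he.1.2.mem_altEnds hinj, (he.1.2.symm splitAdj_symm).twin_mem_altEnds hinj he.2.2
        (he.1.2.ne_of_two_le (by omega)).symm⟩)
  obtain ⟨t, m, I, ht, htm, h1, h2⟩ := altEnds_bound hA hD (P := M.image Prod.fst)
    (by rwa [hP]) (by omega) ⟨_, h.mem_altEnds hinj⟩
  rw [← ht] at hX
  rw [hP, hM] at htm h2
  exact false_of_odd_count h1 hX htm h2 (by omega) hq hk

theorem IsSpanPath.exists_many_nbrs (hA : IsOriented A) {k q : ℕ} (hD : LocallyDense A k)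
    (hmax : ∀ l, IsAlt A l → l.length ≤ M.card)
    (hinj : Set.InjOn Prod.fst (M : Set (V × Bool))) (h : IsSpanPath (splitAdj A) M x y)
    (hM : M.card = 2 * q) (hq : 1 ≤ q) :
    ∃ x', IsSpanPath (splitAdj A) M x' y ∧
      4 * k + 3 ≤ 3 * (M.filter fun t => splitAdj A x' t).card + 6 * q := by
  have hcl : ∀ a b, IsSpanPath (splitAdj A) M a b →
      b.2 = (!a.2) ∧ (M.filter fun m => m.2 = a.2).card = q := by
    intro a b hab
    have h1 := hab.card_filter_snd
    have h2 := card_filter_snd_add M a.2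
    split_ifs at h1 with h3
    · omega
    · exact ⟨by cases ha : a.2 <;> cases hb : b.2 <;> simp_all, by omega⟩
  obtain ⟨u, hu, hout⟩ := exists_card_filter_le (r := fun a b => splitAdj A a (twin b))
    (fun a b hab => hab.not_twin hA) (S := M.filter fun e => IsSpanPath (splitAdj A) M e y)
    (C := M.filter fun m => m.2 = x.2) (by
      intro e he
      obtain ⟨he1, he2⟩ := Finset.mem_filter.1 he
      refine Finset.mem_filter.2 ⟨he1, ?_⟩
      have h1 := (hcl _ _ he2).1
      rw [(hcl _ _ h).1] at h1
      simpa using h1.symm) ⟨x, Finset.mem_filter.2 ⟨h.left_mem, h⟩⟩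
  obtain ⟨hu1, hu2⟩ := Finset.mem_filter.1 hu
  refine ⟨u, hu2, ?_⟩
  have hux : u.2 = x.2 := by
    have h1 := (hcl _ _ hu2).1
    rw [(hcl _ _ h).1] at h1
    simpa using h1.symm
  have hrot := hu2.card_nbrs_le splitAdj_symm splitAdj_irrefl
  have hdeg := hu2.degree_le hmax hinj
  obtain ⟨t0, ht0⟩ := hu2.exists_adj (by omega)
  have hk3 := hD.le_degree ht0
  have heq : (M.filter fun m => splitAdj A u (twin m)) =
      (M.filter fun m => m.2 = x.2).filter fun m => splitAdj A u (twin m) := by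
    ext m
    simp only [Finset.mem_filter]
    refine ⟨fun hm => ⟨⟨hm.1, ?_⟩, hm.2⟩, fun hm => ⟨hm.1.1, hm.2⟩⟩
    have := hm.2.snd_eq
    rw [hux] at this
    simpa [twin] using this
  rw [heq] at hdeg
  rw [(hcl _ _ h).2] at hout
  omega

/-- A longest antipath with an even number `2 * q ≤ k + 1` of vertices is impossible, unless
`k = 3` and `q = 2`. -/
theorem IsSpanPath.false_of_even (hA : IsOriented A) {k q : ℕ} (hD : LocallyDense A k)
    (hmax : ∀ l, IsAlt A l → l.length ≤ M.card)
    (hinj : Set.InjOn Prod.fst (M : Set (V × Bool))) (h : IsSpanPath (splitAdj A) M x y)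
    (hM : M.card = 2 * q) (hq : 1 ≤ q) (hk : 2 * q ≤ k + 1) (hkq : 15 * q < 8 * k + 6) :
    False := by
  obtain ⟨u, hu, hua⟩ := h.exists_many_nbrs hA hD hmax hinj hM hq
  obtain ⟨w, hw, hwa⟩ := (hu.symm splitAdj_symm).exists_many_nbrs hA hD hmax hinj hM hq
  have hbal := hw.card_filter_snd
  have hsum := card_filter_snd_add M w.2
  have hwu : u.2 = !w.2 := by
    split_ifs at hbal with h3
    · omega
    · cases ha : u.2 <;> cases hb : w.2 <;> simp_all
  have hcyc : ∀ m ∈ M, ∃ y', IsSpanPath (splitAdj A) M m y' := fun m hm =>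
    hw.exists_of_crossing splitAdj_symm splitAdj_irrefl (M.filter fun m => m.2 = !w.2)
      (fun t ht hwt => Finset.mem_filter.2 ⟨ht, hwt.snd_eq⟩)
      (fun e _ t ht hue het => Finset.mem_filter.2 ⟨ht, by
        rw [het.snd_eq, hue.snd_eq, hwu]; simp⟩) (by
        split_ifs at hbal <;> omega) hm
  have hsub : M ⊆ altEnds A (M.image Prod.fst) := fun m hm => by
    obtain ⟨y', hy'⟩ := hcyc m hm
    exact hy'.mem_altEnds hinj
  have hP : (M.image Prod.fst).card = M.card := Finset.card_image_of_injOn hinj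
  have hX := Finset.card_le_card hsub
  obtain ⟨t, m, I, ht, htm, h1, h2⟩ := altEnds_bound hA hD (P := M.image Prod.fst)
    (by rwa [hP]) (by omega) ⟨_, h.mem_altEnds hinj⟩
  rw [hP, hM] at h2
  rw [hM] at hX
  exact false_of_even_count h1 hX h2 hq hk

theorem LocallyDense.exists_four_le_degree {k : ℕ} (hk : 3 ≤ k) (hD : LocallyDense A k)
    (hne : ∃ u v, A u v) :
    ∃ x, 4 ≤ (Finset.univ.filter fun t => splitAdj A x t).card := by
  by_contra! hno
  set F := Finset.univ.filter fun p : V × V => A p.1 p.2 with hF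
  set f : V × V → V × Bool := fun p => (p.1, true) with hf
  set g : V × V → V × Bool := fun p => (p.2, false) with hg
  have h1 : F.card ≤ 3 * (F.image f).card := by
    refine Finset.card_le_mul_card_image _ _ fun a _ => ?_
    refine le_trans ?_ (Nat.le_of_lt_succ (hno a))
    refine Finset.card_le_card_of_injOn g ?_ ?_
    · intro p hp
      obtain ⟨h1, rfl⟩ := Finset.mem_filter.1 hp
      exact Finset.mem_filter.2 ⟨Finset.mem_univ _, Or.inl ⟨rfl, rfl, (Finset.mem_filter.1 h1).2⟩⟩
    · intro p hp p' hp' he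
      have h1 := (Finset.mem_filter.1 hp).2
      have h2 := (Finset.mem_filter.1 hp').2
      simp only [hf, hg, Prod.mk.injEq, and_true] at h1 h2 he
      rw [← h2] at h1
      exact Prod.ext (by simpa using h1) he
  have h2 : F.card ≤ 3 * (F.image g).card := by
    refine Finset.card_le_mul_card_image _ _ fun a _ => ?_
    refine le_trans ?_ (Nat.le_of_lt_succ (hno a))
    refine Finset.card_le_card_of_injOn f ?_ ?_
    · intro p hp
      obtain ⟨h1, rfl⟩ := Finset.mem_filter.1 hp
      exact Finset.mem_filter.2 ⟨Finset.mem_univ _, Or.inr ⟨rfl, rfl, (Finset.mem_filter.1 h1).2⟩⟩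
    · intro p hp p' hp' he
      have h1 := (Finset.mem_filter.1 hp).2
      have h2 := (Finset.mem_filter.1 hp').2
      simp only [hf, hg, Prod.mk.injEq, and_true] at h1 h2 he
      rw [← h2] at h1
      exact Prod.ext he (by simpa using h1)
  have hdisj : Disjoint (F.image f) (F.image g) := by
    rw [Finset.disjoint_left]
    intro a ha hb
    obtain ⟨p, -, rfl⟩ := Finset.mem_image.1 ha
    obtain ⟨p', -, h⟩ := Finset.mem_image.1 hb
    simp [hf, hg] at h
  have h3 := hD (F.image f ∪ F.image g) (by
    obtain ⟨u, v, huv⟩ := hne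
    exact ⟨(u, true), Finset.mem_union_left _ (Finset.mem_image.2 ⟨(u, v), by simpa [hF], rfl⟩)⟩) (by
    intro y hy
    rcases Finset.mem_union.1 hy with h | h <;> obtain ⟨p, hp, rfl⟩ := Finset.mem_image.1 h
    · exact ⟨(p.2, false), Or.inl ⟨rfl, rfl, (Finset.mem_filter.1 hp).2⟩⟩
    · exact ⟨(p.1, true), Or.inr ⟨rfl, rfl, (Finset.mem_filter.1 hp).2⟩⟩)
  have h4 : incArcs A (F.image f ∪ F.image g) ≤ F.card := by
    refine Finset.card_le_card fun p hp => ?_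
    simp only [hF, Finset.mem_filter, Finset.mem_univ, true_and] at hp ⊢
    exact hp.1
  rw [Finset.card_union_of_disjoint hdisj] at h3
  nlinarith

theorem LocallyDense.exists_isAlt_length_five (hA : IsOriented A) (hD : LocallyDense A 3)
    (hne : ∃ u v, A u v) : ∃ l, IsAlt A l ∧ l.length = 5 := by
  obtain ⟨x, hx⟩ := hD.exists_four_le_degree le_rfl hne
  have hother : ∀ t, splitAdj A x t → ∃ z, splitAdj A t z ∧ z ≠ x := by
    intro t ht
    have := hD.le_degree (splitAdj_symm _ _ ht)
    obtain ⟨z, hz, hzx⟩ := Finset.exists_mem_ne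
      (s := Finset.univ.filter fun z => splitAdj A t z) (by omega) x
    exact ⟨z, (Finset.mem_filter.1 hz).2, hzx⟩
  choose! f hf hfx using hother
  obtain ⟨S, hS, hcard⟩ := Finset.exists_subset_card_eq hx
  obtain ⟨a, b, c, d, hab, hac, had, hbc, hbd, hcd, rfl⟩ := Finset.card_eq_four.1 hcard
  have hadj : ∀ t ∈ ({a, b, c, d} : Finset _), splitAdj A x t := fun t ht =>
    (Finset.mem_filter.1 (hS ht)).2
  have ha := hadj a (by simp)
  have hb := hadj b (by simp)
  have hc := hadj c (by simp)
  have hd := hadj d (by simp)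
  have hfst : ∀ s t, splitAdj A x s → splitAdj A x t → s ≠ t → s.1 ≠ t.1 := fun s t hs ht hst he =>
    hst (Prod.ext he (hs.snd_eq.trans ht.snd_eq.symm))
  have hfx1 : ∀ t, splitAdj A x t → (f t).1 ≠ x.1 := fun t ht he =>
    hfx t ht (Prod.ext he (by rw [(hf t ht).snd_eq, ht.snd_eq]; simp))
  have hff1 : ∀ s t, splitAdj A x s → splitAdj A x t → f s ≠ f t → (f s).1 ≠ (f t).1 :=
    fun s t hs ht hst he => hst (Prod.ext he (by
      rw [(hf t ht).snd_eq, ht.snd_eq, (hf s hs).snd_eq, hs.snd_eq]))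
  have hcommon : ∀ s t u, splitAdj A x s → splitAdj A x t → splitAdj A x u → s ≠ t → s ≠ u →
      t ≠ u → f s = f t → (f s).1 ≠ u.1 → ∃ l, IsAlt A l ∧ l.length = 5 := by
    intro s t u hs ht hu hst hsu htu he hne
    have h1 := hf s hs
    have h2 := hf t ht
    have h3 := hfst s t hs ht hst
    have h4 := hfst s u hs hu hsu
    have h5 := hfst t u ht hu htu
    have h6 := h1.fst_ne hA
    have h7 := h2.fst_ne hA
    have h8 := hs.fst_ne hA
    have h9 := ht.fst_ne hA
    have h10 := hu.fst_ne hA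
    have h11 := hfx1 s hs
    rw [← he] at h2 h7
    refine ⟨[s, f s, t, x, u], ⟨?_, ?_⟩, rfl⟩
    · simp [h1, splitAdj_symm _ _ h2, splitAdj_symm _ _ ht, hu]
    · simp
      grind
  have hpair : ∀ s t, splitAdj A x s → splitAdj A x t → s ≠ t → f s ≠ f t →
      (f s).1 ≠ t.1 → (f t).1 ≠ s.1 → ∃ l, IsAlt A l ∧ l.length = 5 := by
    intro s t hs ht hst hne hst1 hts1
    have h1 := hf s hs
    have h2 := hf t ht
    have h3 := hfst s t hs ht hst
    have h4 := hff1 s t hs ht hne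
    have h6 := h1.fst_ne hA
    have h7 := h2.fst_ne hA
    have h8 := hs.fst_ne hA
    have h9 := ht.fst_ne hA
    have h10 := hfx1 s hs
    have h11 := hfx1 t ht
    refine ⟨[f s, s, x, t, f t], ⟨?_, ?_⟩, rfl⟩
    · simp [splitAdj_symm _ _ h1, splitAdj_symm _ _ hs, ht, h2]
    · simp
      grind
  have hcommon' : ∀ s t u v, splitAdj A x s → splitAdj A x t → splitAdj A x u → splitAdj A x v →
      s ≠ t → s ≠ u → t ≠ u → s ≠ v → t ≠ v → u ≠ v → f s = f t →
      ∃ l, IsAlt A l ∧ l.length = 5 := by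
    intro s t u v hs ht hu hv hst hsu htu hsv htv huv he
    by_cases h : (f s).1 = u.1
    · exact hcommon s t v hs ht hv hst hsv htv he
        (fun h' => hfst u v hu hv huv (h.symm.trans h'))
    · exact hcommon s t u hs ht hu hst hsu htu he h
  by_contra hno
  have key : ∀ s t, splitAdj A x s → splitAdj A x t → s ≠ t → f s ≠ f t →
      (f s).1 = t.1 ∨ (f t).1 = s.1 := by
    intro s t hs ht hst hne
    by_contra! h
    exact hno (hpair s t hs ht hst hne h.1 h.2)
  have k1 := key a b ha hb hab fun h =>
    hno (hcommon' a b c d ha hb hc hd hab hac hbc had hbd hcd h)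
  have k2 := key a c ha hc hac fun h =>
    hno (hcommon' a c b d ha hc hb hd hac hab hbc.symm had hcd hbd h)
  have k3 := key a d ha hd had fun h =>
    hno (hcommon' a d b c ha hd hb hc had hab hbd.symm hac hcd.symm hbc h)
  have k4 := key b c hb hc hbc fun h =>
    hno (hcommon' b c a d hb hc ha hd hbc hab.symm hac.symm hbd hcd had h)
  have k5 := key b d hb hd hbd fun h =>
    hno (hcommon' b d a c hb hd ha hc hbd hab.symm had.symm hbc hcd.symm hac h)
  have k6 := key c d hc hd hcd fun h =>
    hno (hcommon' c d a b hc hd ha hb hcd hac.symm had.symm hbc.symm hbd.symm hab h)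
  have e1 := hfst a b ha hb hab
  have e2 := hfst a c ha hc hac
  have e3 := hfst a d ha hd had
  have e4 := hfst b c hb hc hbc
  have e5 := hfst b d hb hd hbd
  have e6 := hfst c d hc hd hcd
  clear * - k1 k2 k3 k4 k5 k6 e1 e2 e3 e4 e5 e6
  grind

theorem LocallyDense.exists_isAlt (hA : IsOriented A) {k : ℕ} (hk : 2 ≤ k)
    (hD : LocallyDense A k) (hne : ∃ u v, A u v) : ∃ l, IsAlt A l ∧ k + 2 ≤ l.length := by
  by_contra! hno
  obtain ⟨u, v, huv⟩ := hne
  have hshort : IsAlt A [(u, true), (v, false)] := by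
    refine ⟨by simp [splitAdj, huv], ?_⟩
    have : u ≠ v := by rintro rfl; exact hA.1 u huv
    simpa using this
  obtain ⟨n, ⟨l, hl, hln⟩, hmax⟩ : ∃ n, (∃ l, IsAlt A l ∧ l.length = n) ∧
      ∀ l, IsAlt A l → l.length ≤ n := by
    have hbdd : BddAbove {n | ∃ l, IsAlt A l ∧ l.length = n} :=
      ⟨k + 2, by rintro _ ⟨l, hl, rfl⟩; exact (hno l hl).le⟩
    have hnon : {n | ∃ l, IsAlt A l ∧ l.length = n}.Nonempty := ⟨_, _, hshort, rfl⟩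
    exact ⟨_, Nat.sSup_mem hnon hbdd, fun l hl => le_csSup hbdd ⟨l, hl, rfl⟩⟩
  have hn2 : 2 ≤ n := hmax _ hshort
  have hnk := hno l hl
  have hcard : l.toFinset.card = n := by rw [List.toFinset_card_of_nodup hl.nodup, hln]
  have hinj : Set.InjOn Prod.fst (l.toFinset : Set (V × Bool)) := by
    intro a ha b hb hab
    exact List.inj_on_of_nodup_map hl.2 (by simpa using ha) (by simpa using hb) hab
  have hlne : l ≠ [] := by rintro rfl; simp at hln; omega
  have hpath : IsSpanPath (splitAdj A) l.toFinset (l.head hlne) (l.getLast hlne) :=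
    ⟨l, hl.1, hl.nodup, by ext; simp, List.head?_eq_some_head hlne,
      List.getLast?_eq_some_getLast hlne⟩
  rcases Nat.even_or_odd' n with ⟨q, hq | hq⟩
  · by_cases h3 : k = 3 ∧ q = 2
    · obtain ⟨rfl, rfl⟩ := h3
      obtain ⟨l', hl', h5⟩ := hD.exists_isAlt_length_five hA ⟨u, v, huv⟩
      have := hmax l' hl'
      omega
    · exact hpath.false_of_even hA hD (by rwa [hcard]) hinj (q := q) (by omega) (by omega)
        (by omega) (by omega)
  · exact hpath.false_of_odd hA hD (by rwa [hcard]) hinj (q := q) (by omega) (by omega) (by omega)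

end LongestAntipath

/-- Let `k ≥ 2` and let `D` be a finite oriented graph with more than `(4k-1)|V(D)|/3`
arcs.  Then `D` contains an anti-directed path of length at least `k + 1` or an
anti-directed cycle of length at least `k + 1`. -/
theorem antipath_or_anticycle_of_many_arcs
    {V : Type*} [Fintype V] (A : V → V → Prop) (hA : IsOriented A)
    (k : ℕ) (hk : 2 ≤ k)
    (harcs : (4 * (k : ℚ) - 1) * (Fintype.card V : ℚ) / 3
      < ({p : V × V | A p.1 p.2}.ncard : ℚ)) :
    (∃ ℓ, k + 1 ≤ ℓ ∧ HasAntipath A ℓ) ∨ (∃ ℓ, k + 1 ≤ ℓ ∧ HasAnticycle A ℓ) := by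
  classical
  have hcard : ({p : V × V | A p.1 p.2}.ncard : ℚ) =
      ((Finset.univ.filter fun p : V × V => A p.1 p.2).card : ℚ) := by
    rw [Set.ncard_eq_toFinset_card']
    congr 2
    ext
    simp
  rw [hcard] at harcs
  obtain ⟨B, hBA, hB, hD⟩ := exists_locallyDense (A := A) (k := k) (by omega) (by
    have : 4 * (k : ℚ) * (2 * Fintype.card V) <
        6 * ((Finset.univ.filter fun p : V × V => A p.1 p.2).card : ℚ) +
          2 * Fintype.card V := by linarith
    convert (by exact_mod_cast this : _ < _) using 1)
  have hBo : IsOriented B :=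
    ⟨fun v hv => hA.1 v (hBA _ _ hv), fun u v h h' => hA.2 u v (hBA _ _ h) (hBA _ _ h')⟩
  obtain ⟨l, hl, hlen⟩ := hD.exists_isAlt hBo hk hB
  have hlA : IsAlt A l := by
    refine ⟨hl.1.imp fun a b hab => ?_, hl.2⟩
    exact hab.imp (fun h => ⟨h.1, h.2.1, hBA _ _ h.2.2⟩) (fun h => ⟨h.1, h.2.1, hBA _ _ h.2.2⟩)
  exact Or.inl ⟨l.length - 1, by omega, hlA.hasAntipath (by omega)⟩
end

section
/- Let k ≥ 4 be an integer and let D be a finite oriented graph with minimum pseudo-semi-degree δ̃⁰(D) ≥ (2k+1)/3. If D contains an anti-directed cycle of length s with s ≤ k, then D contains an anti-directed path of length at least s. -/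
open Classical in
/-- `AntipathFrom A b z F`: there is an antipath with vertex set `F` and first vertex `z`,
where `z` is a source of the path if `b` is true and a sink otherwise. -/
inductive AntipathFrom {V : Type*} (A : V → V → Prop) : Bool → V → Finset V → Prop
  | single (b : Bool) (z : V) : AntipathFrom A b z {z}
  | source {w y : V} {F : Finset V} : AntipathFrom A false y F → w ∉ F → A w y →
      AntipathFrom A true w (insert w F)
  | sink {w y : V} {F : Finset V} : AntipathFrom A true y F → w ∉ F → A y w →
      AntipathFrom A false w (insert w F)

open Classical in
theorem AntipathFrom.exists_seq {V : Type*} {A : V → V → Prop} {b : Bool} {z : V}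
    {F : Finset V} (h : AntipathFrom A b z F) :
    ∃ (ℓ : ℕ) (x : ℕ → V), F.card = ℓ + 1 ∧ x 0 = z ∧ (∀ i ≤ ℓ, x i ∈ F) ∧
      (∀ i ≤ ℓ, ∀ j ≤ ℓ, x i = x j → i = j) ∧
      ∀ i < ℓ, if (i % 2 = 0 ↔ b = true) then A (x i) (x (i + 1)) else A (x (i + 1)) (x i) := by
  induction h with
  | single b z => exact ⟨0, fun _ => z, by simp, rfl, by simp, by omega, by omega⟩
  | @source w y F _ hw hwy ih =>
    obtain ⟨ℓ, x, hc, h0, hm, hi, ha⟩ := ih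
    refine ⟨ℓ + 1, fun n => Nat.casesOn n w x, ?_, rfl, ?_, ?_, ?_⟩
    · rw [Finset.card_insert_of_notMem hw, hc]
    · rintro (_ | i) h
      · simp
      · exact Finset.mem_insert_of_mem (hm i (by omega))
    · rintro (_ | i) h (_ | j) h' e
      · rfl
      · exact absurd ((show w = x j from e) ▸ hm j (by omega)) hw
      · exact absurd ((show x i = w from e) ▸ hm i (by omega)) hw
      · rw [hi i (by omega) j (by omega) e]
    · rintro (_ | i) h
      · simpa [h0] using hwy
      · have := ha i (by omega)
        have e : ((i + 1) % 2 = 0 ↔ true = true) ↔ (i % 2 = 0 ↔ false = true) := by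
          simp; omega
        rwa [← if_congr e rfl rfl] at this
  | @sink w y F _ hw hwy ih =>
    obtain ⟨ℓ, x, hc, h0, hm, hi, ha⟩ := ih
    refine ⟨ℓ + 1, fun n => Nat.casesOn n w x, ?_, rfl, ?_, ?_, ?_⟩
    · rw [Finset.card_insert_of_notMem hw, hc]
    · rintro (_ | i) h
      · simp
      · exact Finset.mem_insert_of_mem (hm i (by omega))
    · rintro (_ | i) h (_ | j) h' e
      · rfl
      · exact absurd ((show w = x j from e) ▸ hm j (by omega)) hw
      · exact absurd ((show x i = w from e) ▸ hm i (by omega)) hw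
      · rw [hi i (by omega) j (by omega) e]
    · rintro (_ | i) h
      · simpa [h0] using hwy
      · have := ha i (by omega)
        have e : ((i + 1) % 2 = 0 ↔ false = true) ↔ (i % 2 = 0 ↔ true = true) := by
          simp; omega
        rwa [← if_congr e rfl rfl] at this

theorem AntipathFrom.hasAntipath {V : Type*} {A : V → V → Prop} {b : Bool} {z : V}
    {F : Finset V} (h : AntipathFrom A b z F) : HasAntipath A (F.card - 1) := by
  obtain ⟨ℓ, x, hc, -, -, hi, ha⟩ := h.exists_seq
  rw [hc, Nat.add_sub_cancel]
  refine ⟨fun i => x i, fun i j e => Fin.ext (hi i (by omega) j (by omega) e), ?_⟩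
  cases b
  · right
    intro i
    have := ha i i.2
    by_cases p : (i : ℕ) % 2 = 0 <;> simp_all
  · left
    intro i
    have := ha i i.2
    by_cases p : (i : ℕ) % 2 = 0 <;> simp_all

/-- An anticycle unrolled to a periodic sequence whose even terms are the sources. -/
structure IsUnrolledAnticycle {V : Type*} (A : V → V → Prop) (m : ℕ) (v : ℕ → V) : Prop where
  inj : ∀ i j, v i = v j ↔ i % (2 * m) = j % (2 * m)
  even : ∀ i, A (v (2 * i)) (v (2 * i + 1))
  odd : ∀ i, A (v (2 * i + 2)) (v (2 * i + 1))

theorem HasAnticycle.exists_unrolled {V : Type*} {A : V → V → Prop} (hA : IsOriented A) {s : ℕ}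
    (h : HasAnticycle A s) : ∃ m v, s = 2 * m ∧ 2 ≤ m ∧ IsUnrolledAnticycle A m v := by
  obtain ⟨hs, u, hu, hc⟩ := h
  have next (i : ZMod s) (h : A (u i) (u (i + 1))) : A (u (i + 2)) (u (i + 1)) ∧
      A (u (i + 2)) (u (i + 3)) := by
    have h1 : A (u (i + 2)) (u (i + 1)) := by
      rcases hc (i + 1) with h' | h'
      · rw [add_sub_cancel_right] at h'
        exact absurd h'.2 (hA.2 _ _ h)
      · rw [add_assoc, one_add_one_eq_two] at h'
        exact h'.1
    refine ⟨h1, ?_⟩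
    have e : i + 2 - 1 = i + 1 := by ring
    have e' : i + 2 + 1 = i + 3 := by ring
    rcases hc (i + 2) with h' | h'
    · rw [e'] at h'
      exact h'.1
    · rw [e] at h'
      exact absurd h'.2 (hA.2 _ _ h1)
  obtain ⟨a, ha⟩ : ∃ a, A (u a) (u (a + 1)) := by
    rcases hc 0 with h' | h'
    · exact ⟨_, h'.1⟩
    · refine ⟨-1, ?_⟩
      rw [neg_add_cancel]
      simpa using h'.2
  have hev (i : ℕ) : A (u (a + (2 * i : ℕ))) (u (a + (2 * i + 1 : ℕ))) := by
    induction i with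
    | zero => simpa using ha
    | succ i ih =>
      have := (next (a + (2 * i : ℕ)) (by convert ih using 2; push_cast; ring)).2
      convert this using 2 <;> push_cast <;> ring
  have hod (i : ℕ) : A (u (a + (2 * i + 2 : ℕ))) (u (a + (2 * i + 1 : ℕ))) := by
    have := (next (a + (2 * i : ℕ)) (by convert hev i using 2; push_cast; ring)).1
    convert this using 2 <;> push_cast <;> ring
  rcases Nat.even_or_odd' s with ⟨m, hm | hm⟩
  · refine ⟨m, fun i => u (a + i), hm, by omega, ?_, hev, hod⟩
    intro i j
    rw [hu.eq_iff, add_right_inj, ZMod.natCast_eq_natCast_iff, hm]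
    rfl
  · have h1 := hod m
    have e1 : (((2 * m + 1 : ℕ)) : ZMod s) = 0 := by rw [← hm]; simp
    have e2 : (((2 * m + 2 : ℕ)) : ZMod s) = 1 := by
      rw [show 2 * m + 2 = (2 * m + 1) + 1 by ring, Nat.cast_add, e1]; simp
    rw [e1, e2, add_zero] at h1
    exact absurd h1 (hA.2 _ _ ha)

namespace IsUnrolledAnticycle

variable {V : Type*} {A : V → V → Prop} {m : ℕ} {v : ℕ → V}

theorem injOn_Icc (h : IsUnrolledAnticycle A m v) (n l : ℕ) (hl : l < 2 * m) :
    Set.InjOn v (Finset.Icc n (n + l)) := by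
  intro i hi j hj e
  simp only [Finset.coe_Icc, Set.mem_Icc] at hi hj
  have := (h.inj i j).1 e
  have h1 := Nat.div_add_mod i (2 * m)
  have h2 := Nat.div_add_mod j (2 * m)
  rcases lt_trichotomy (i / (2 * m)) (j / (2 * m)) with h3 | h3 | h3
  · nlinarith
  · rw [← h1, ← h2, this, h3]
  · nlinarith

open Classical in
theorem antipathFrom_ascending (h : IsUnrolledAnticycle A m v) (l : ℕ) :
    ∀ n, l < 2 * m → AntipathFrom A (decide (n % 2 = 0)) (v n)
      ((Finset.Icc n (n + l)).image v) := by
  induction l with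
  | zero => intro n _; simpa using AntipathFrom.single _ _
  | succ l ih =>
    intro n hl
    have ih := ih (n + 1) (by omega)
    have e : Finset.Icc n (n + (l + 1)) = insert n (Finset.Icc (n + 1) (n + 1 + l)) := by
      ext; simp; omega
    have hn : v n ∉ (Finset.Icc (n + 1) (n + 1 + l)).image v := by
      intro hm
      obtain ⟨j, hj, e⟩ := Finset.mem_image.1 hm
      rw [Finset.mem_Icc] at hj
      have := h.injOn_Icc n (l + 1) hl (by simp; omega) (by simp) e
      omega
    rw [e, Finset.image_insert]
    rcases Nat.even_or_odd' n with ⟨i, rfl | rfl⟩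
    · have e1 : decide ((2 * i + 1) % 2 = 0) = false := by simp
      have e2 : decide ((2 * i) % 2 = 0) = true := by simp
      rw [e1] at ih
      rw [e2]
      exact .source ih hn (h.even i)
    · have e1 : decide ((2 * i + 1) % 2 = 0) = false := by simp
      have e2 : decide ((2 * i + 1 + 1) % 2 = 0) = true := by simp; omega
      rw [e2] at ih
      rw [e1]
      exact .sink ih hn (h.odd i)

open Classical in
theorem antipathFrom_descending (h : IsUnrolledAnticycle A m v) (n l : ℕ) :
    l < 2 * m → AntipathFrom A (decide ((n + l) % 2 = 0)) (v (n + l))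
      ((Finset.Icc n (n + l)).image v) := by
  induction l with
  | zero => intro _; simpa using AntipathFrom.single _ _
  | succ l ih =>
    intro hl
    have ih := ih (by omega)
    have e : Finset.Icc n (n + (l + 1)) = insert (n + (l + 1)) (Finset.Icc n (n + l)) := by
      ext; simp; omega
    have hn : v (n + (l + 1)) ∉ (Finset.Icc n (n + l)).image v := by
      intro hm
      obtain ⟨j, hj, e⟩ := Finset.mem_image.1 hm
      rw [Finset.mem_Icc] at hj
      have := h.injOn_Icc n (l + 1) hl (by simp; omega) (by simp) e
      omega
    rw [e, Finset.image_insert]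
    rcases Nat.even_or_odd' (n + l) with ⟨i, hi | hi⟩
    · rw [show n + (l + 1) = 2 * i + 1 by omega] at hn ⊢
      rw [hi] at ih
      have e1 : decide ((2 * i + 1) % 2 = 0) = false := by simp
      have e2 : decide ((2 * i) % 2 = 0) = true := by simp
      rw [e2] at ih
      rw [e1, hi]
      rw [hi] at hn
      exact .sink ih hn (h.even i)
    · rw [show n + (l + 1) = 2 * i + 2 by omega] at hn ⊢
      rw [hi] at ih
      have e1 : decide ((2 * i + 1) % 2 = 0) = false := by simp
      have e2 : decide ((2 * i + 2) % 2 = 0) = true := by simp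
      rw [e1] at ih
      rw [e2, hi]
      rw [hi] at hn
      exact .source ih hn (h.odd i)

end IsUnrolledAnticycle

open Classical in
theorem exists_inNeighbor_notMem {V : Type*} [Fintype V] {A : V → V → Prop} (hA : IsOriented A)
    {S T F : Finset V} {d r s : ℕ} {z : V} (hST : (S ∪ T).card = s) (hF : F.card ≤ s)
    (hFS : r ≤ (F ∩ S).card) (hFST : 2 * r + 1 ≤ (F ∩ (S ∪ T)).card) (hdr : s < d + r + 1)
    (hout : ∀ a ∈ S, ∀ w, A a w → w ∈ S ∪ T) (hzF : z ∈ F) (hzT : z ∉ T)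
    (hin : d ≤ (Finset.univ.filter fun w => A w z).card)
    (hzS : z ∈ S → d ≤ (Finset.univ.filter fun w => A z w).card) :
    ∃ w, A w z ∧ w ∉ F ∧ w ∉ S := by
  by_contra! hcon
  by_cases hz : z ∈ S
  · have h1 := Finset.card_inter_add_card_sdiff F (S ∪ T)
    have h2 : (Finset.univ.filter fun w => A w z) ∪ (Finset.univ.filter fun w => A z w) ⊆
        (F \ (S ∪ T)) ∪ (S ∪ T).erase z := by
      intro w hw
      have hwz : w ≠ z := by
        rintro rfl
        simp [hA.1] at hw
      by_cases hwC : w ∈ S ∪ T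
      · simp_all
      · have hw' : A w z := by
          rcases Finset.mem_union.1 hw with h | h
          · simpa using h
          · exact absurd (hout z hz w (by simpa using h)) hwC
        have : w ∈ F := by
          by_contra hwF
          exact hwC (Finset.mem_union_left _ (hcon w hw' hwF))
        simp only [Finset.mem_union, Finset.mem_sdiff]
        exact Or.inl ⟨this, by simpa using hwC⟩
    have h3 : Disjoint (Finset.univ.filter fun w => A w z) (Finset.univ.filter fun w => A z w) := by
      rw [Finset.disjoint_filter]
      exact fun w _ h => hA.2 _ _ h
    have h4 := Finset.card_le_card h2
    rw [Finset.card_union_of_disjoint h3] at h4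
    have h5 := Finset.card_union_le (F \ (S ∪ T)) ((S ∪ T).erase z)
    have h6 := Finset.card_erase_add_one (Finset.mem_union_left T hz)
    have := hzS hz
    omega
  · have hzC : z ∉ S ∪ T := by simp [hz, hzT]
    have h1 := Finset.card_inter_add_card_sdiff F S
    have h2 : (Finset.univ.filter fun w => A w z) ⊆ (F \ S).erase z := by
      intro w hw
      have hw' : A w z := by simpa using hw
      have hwS : w ∉ S := fun h => hzC (hout w h z hw')
      refine Finset.mem_erase.2 ⟨?_, Finset.mem_sdiff.2 ⟨?_, hwS⟩⟩
      · rintro rfl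
        exact hA.1 _ hw'
      · by_contra hwF
        exact hwS (hcon w hw' hwF)
    have h3 := Finset.card_le_card h2
    have h4 := Finset.card_erase_add_one (Finset.mem_sdiff.2 ⟨hzF, hz⟩)
    omega

theorem AntipathFrom.mem {V : Type*} {A : V → V → Prop} {b : Bool} {z : V}
    {F : Finset V} (h : AntipathFrom A b z F) : z ∈ F := by
  cases h <;> simp

open Classical in
theorem exists_antipathFrom_card_ge {V : Type*} [Fintype V] {A : V → V → Prop}
    (hA : IsOriented A) {S T F₀ : Finset V} {d r s : ℕ} {z₀ : V} (hST : (S ∪ T).card = s)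
    (hdisj : Disjoint S T) (hFS : r + 1 ≤ (F₀ ∩ S).card) (hFT : r ≤ (F₀ ∩ T).card)
    (hdr : s < d + r + 1)
    (hout : ∀ a ∈ S, ∀ w, A a w → w ∈ S ∪ T) (hin : ∀ b ∈ T, ∀ w, A w b → w ∈ S ∪ T)
    (hdout : ∀ v w, A v w → d ≤ (Finset.univ.filter fun w => A v w).card)
    (hdin : ∀ v w, A w v → d ≤ (Finset.univ.filter fun w => A w v).card)
    (hS : ∀ a ∈ S, ∃ w, A a w) (hT : ∀ b ∈ T, ∃ w, A w b)
    (h₀ : AntipathFrom A false z₀ F₀) (hz₀ : z₀ ∉ T) (hz₀' : ∃ w, A w z₀) (n : ℕ)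
    (hn : n ≤ s + 1) : ∃ b z F, AntipathFrom A b z F ∧ n ≤ F.card := by
  suffices ∃ z F, ((AntipathFrom A false z F ∧ z ∉ T ∧ ∃ w, A w z) ∨
      (AntipathFrom A true z F ∧ z ∉ S ∧ ∃ w, A z w)) ∧ F₀ ⊆ F ∧ n ≤ F.card by
    obtain ⟨z, F, h | h, -, hc⟩ := this
    exacts [⟨_, _, _, h.1, hc⟩, ⟨_, _, _, h.1, hc⟩]
  induction n with
  | zero => exact ⟨z₀, F₀, Or.inl ⟨h₀, hz₀, hz₀'⟩, subset_rfl, Nat.zero_le _⟩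
  | succ n ih =>
    obtain ⟨z, F, hF, hF₀, hc⟩ := ih (by omega)
    rcases hc.lt_or_eq with hc | rfl
    · exact ⟨z, F, hF, hF₀, hc⟩
    have h1 := Finset.card_le_card (Finset.inter_subset_inter_right (u := S) hF₀)
    have h2 := Finset.card_le_card (Finset.inter_subset_inter_right (u := T) hF₀)
    have h3 : (F ∩ (S ∪ T)).card = (F ∩ S).card + (F ∩ T).card := by
      rw [Finset.inter_union_distrib_left, Finset.card_union_of_disjoint]
      exact hdisj.mono Finset.inter_subset_right Finset.inter_subset_right
    rcases hF with ⟨hF, hz, w₀, hw₀⟩ | ⟨hF, hz, w₀, hw₀⟩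
    · obtain ⟨w, hwz, hwF, hwS⟩ := exists_inNeighbor_notMem hA hST (by omega) (r := r)
        (by omega) (by omega) hdr hout hF.mem hz (hdin _ _ hw₀)
        (fun h => (hS z h).elim fun w hw => hdout _ _ hw)
      refine ⟨w, insert w F, Or.inr ⟨.source hF hwF hwz, hwS, z, hwz⟩,
        hF₀.trans (Finset.subset_insert _ _), ?_⟩
      rw [Finset.card_insert_of_notMem hwF]
    · obtain ⟨w, hwz, hwF, hwS⟩ := exists_inNeighbor_notMem (A := flip A) (S := T) (T := S)
        ⟨hA.1, fun u v h => hA.2 _ _ h⟩ (by rwa [Finset.union_comm]) (by omega) (r := r) (F := F)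
        (by omega) (by rw [Finset.union_comm]; omega) hdr
        (by rw [Finset.union_comm]; exact hin) hF.mem hz (hdout _ _ hw₀)
        (fun h => (hT z h).elim fun w hw => hdin _ _ hw)
      refine ⟨w, insert w F, Or.inl ⟨.sink hF hwF hwz, hwS, z, hwz⟩,
        hF₀.trans (Finset.subset_insert _ _), ?_⟩
      rw [Finset.card_insert_of_notMem hwF]

namespace IsUnrolledAnticycle

variable {V : Type*} {A : V → V → Prop} {m : ℕ} {v : ℕ → V}

open Classical in
theorem card_image_two_mul_add (h : IsUnrolledAnticycle A m v) (c a l : ℕ) (hl : l ≤ m) :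
    ((Finset.Ico a (a + l)).image fun i => v (2 * i + c)).card = l := by
  rw [Finset.card_image_of_injOn, Nat.card_Ico, Nat.add_sub_cancel_left]
  intro i hi j hj e
  simp only [Finset.coe_Ico, Set.mem_Ico] at hi hj
  wlog hij : i ≤ j generalizing i j
  · exact (this e.symm hj hi (by omega)).symm
  have := h.injOn_Icc (2 * i + c) (2 * (j - i)) (by omega) (by simp)
    (by simp; omega : 2 * j + c ∈ _) e
  omega

open Classical in
/-- The set of sources of an unrolled anticycle. -/
noncomputable def sources (_ : IsUnrolledAnticycle A m v) : Finset V :=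
  (Finset.Ico 0 (0 + m)).image fun i => v (2 * i + 0)

open Classical in
/-- The set of sinks of an unrolled anticycle. -/
noncomputable def sinks (_ : IsUnrolledAnticycle A m v) : Finset V :=
  (Finset.Ico 0 (0 + m)).image fun i => v (2 * i + 1)

open Classical in
theorem two_mul_mem_sources (h : IsUnrolledAnticycle A m v) (hm : 0 < m) (i : ℕ) :
    v (2 * i) ∈ h.sources := by
  refine Finset.mem_image.2 ⟨i % m, by simpa using Nat.mod_lt _ hm, (h.inj _ _).2 ?_⟩
  simp [Nat.mul_mod_mul_left]

open Classical in
theorem two_mul_add_one_mem_sinks (h : IsUnrolledAnticycle A m v) (hm : 0 < m) (i : ℕ) :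
    v (2 * i + 1) ∈ h.sinks := by
  refine Finset.mem_image.2 ⟨i % m, by simpa using Nat.mod_lt _ hm, (h.inj _ _).2 ?_⟩
  exact Nat.ModEq.add_right 1 (by simp [Nat.ModEq, Nat.mul_mod_mul_left])

theorem exists_of_mem_sources (h : IsUnrolledAnticycle A m v) {a : V} (ha : a ∈ h.sources) :
    ∃ i < m, v (2 * i) = a := by
  simpa [sources] using ha

theorem exists_of_mem_sinks (h : IsUnrolledAnticycle A m v) {a : V} (ha : a ∈ h.sinks) :
    ∃ i < m, v (2 * i + 1) = a := by
  simpa [sinks] using ha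

theorem disjoint_sources_sinks (h : IsUnrolledAnticycle A m v) :
    Disjoint h.sources h.sinks := by
  rw [Finset.disjoint_left]
  intro a ha hb
  obtain ⟨i, hi, rfl⟩ := h.exists_of_mem_sources ha
  obtain ⟨j, hj, e⟩ := h.exists_of_mem_sinks hb
  rw [h.inj, Nat.mod_eq_of_lt (by omega), Nat.mod_eq_of_lt (by omega)] at e
  omega

open Classical in
theorem card_sources_union_sinks (h : IsUnrolledAnticycle A m v) :
    (h.sources ∪ h.sinks).card = 2 * m := by
  rw [Finset.card_union_of_disjoint h.disjoint_sources_sinks, sources, sinks,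
    h.card_image_two_mul_add _ _ _ le_rfl, h.card_image_two_mul_add _ _ _ le_rfl, two_mul]

open Classical in
theorem mem_sources_union_sinks (h : IsUnrolledAnticycle A m v) (hm : 0 < m) (k : ℕ) :
    v k ∈ h.sources ∪ h.sinks := by
  rcases Nat.even_or_odd' k with ⟨i, rfl | rfl⟩
  · exact Finset.mem_union_left _ (h.two_mul_mem_sources hm i)
  · exact Finset.mem_union_right _ (h.two_mul_add_one_mem_sinks hm i)

open Classical in
theorem card_image_insert (h : IsUnrolledAnticycle A m v) (hm : 0 < m) (n : ℕ) {w : V}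
    (hw : w ∉ h.sources ∪ h.sinks) :
    w ∉ (Finset.Icc n (n + (2 * m - 1))).image v ∧
      (insert w ((Finset.Icc n (n + (2 * m - 1))).image v)).card = 2 * m + 1 := by
  have hw' : w ∉ (Finset.Icc n (n + (2 * m - 1))).image v := by
    intro hmem
    obtain ⟨k, -, rfl⟩ := Finset.mem_image.1 hmem
    exact hw (h.mem_sources_union_sinks hm k)
  refine ⟨hw', ?_⟩
  rw [Finset.card_insert_of_notMem hw', Finset.card_image_of_injOn (h.injOn_Icc _ _ (by omega)),
    Nat.card_Icc]
  omega

open Classical in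
theorem outNeighbor_mem (h : IsUnrolledAnticycle A m v) (hm : 0 < m)
    (hmax : ∀ b z F, AntipathFrom A b z F → F.card ≤ 2 * m) {a : V} (ha : a ∈ h.sources)
    (w : V) (haw : A a w) : w ∈ h.sources ∪ h.sinks := by
  by_contra hw
  obtain ⟨i, -, rfl⟩ := h.exists_of_mem_sources ha
  obtain ⟨h1, h2⟩ := h.card_image_insert hm (2 * i) hw
  have h3 := h.antipathFrom_ascending (2 * m - 1) (2 * i) (by omega)
  rw [show decide (2 * i % 2 = 0) = true by simp] at h3
  have := hmax _ _ _ (.sink h3 h1 haw)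
  omega

open Classical in
theorem inNeighbor_mem (h : IsUnrolledAnticycle A m v) (hm : 0 < m)
    (hmax : ∀ b z F, AntipathFrom A b z F → F.card ≤ 2 * m) {a : V} (ha : a ∈ h.sinks)
    (w : V) (haw : A w a) : w ∈ h.sources ∪ h.sinks := by
  by_contra hw
  obtain ⟨i, -, rfl⟩ := h.exists_of_mem_sinks ha
  obtain ⟨h1, h2⟩ := h.card_image_insert hm (2 * i + 1) hw
  have h3 := h.antipathFrom_ascending (2 * m - 1) (2 * i + 1) (by omega)
  rw [show decide ((2 * i + 1) % 2 = 0) = false by simp] at h3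
  have := hmax _ _ _ (.source h3 h1 haw)
  omega

open Classical in
theorem exists_chord [Fintype V] (h : IsUnrolledAnticycle A m v) (hm : 2 ≤ m)
    (hA : IsOriented A) (hout : ∀ w, A (v 0) w → w ∈ h.sources ∪ h.sinks)
    (hdeg : 4 * m + 1 ≤ 3 * (Finset.univ.filter fun w => A (v 0) w).card) :
    ∃ e, 1 ≤ e ∧ e < m ∧ A (v 0) (v (2 * e)) ∧ (2 * m < 3 * e + 4 ∨ 2 * m < 3 * (m - e) + 4) := by
  by_contra! hcon
  have hsub : (Finset.univ.filter fun w => A (v 0) w) ⊆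
      h.sinks ∪ (Finset.Icc ((m + 6) / 3) ((2 * m - 4) / 3)).image fun i => v (2 * i) := by
    intro w hw
    have hw : A (v 0) w := by simpa using hw
    rcases Finset.mem_union.1 (hout w hw) with hs | ht
    · obtain ⟨e, he, rfl⟩ := h.exists_of_mem_sources hs
      have he1 : 1 ≤ e := by
        rcases Nat.eq_zero_or_pos e with rfl | h
        · exact absurd hw (hA.1 _)
        · exact h
      have := hcon e he1 he hw
      refine Finset.mem_union_right _ (Finset.mem_image_of_mem (fun i => v (2 * i)) ?_)
      rw [Finset.mem_Icc]
      omega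
    · exact Finset.mem_union_left _ ht
  have h1 := (Finset.card_le_card hsub).trans (Finset.card_union_le _ _)
  have h2 := h.card_image_two_mul_add 1 0 m le_rfl
  have h3 : (Finset.image (fun i => v (2 * i))
    (Finset.Icc ((m + 6) / 3) ((2 * m - 4) / 3))).card ≤ _ := Finset.card_image_le
  rw [Nat.card_Icc] at h3
  rw [sinks, h2] at h1
  omega

open Classical in
theorem exists_antipathFrom_of_chord (h : IsUnrolledAnticycle A m v) {e : ℕ} (he : 1 ≤ e)
    (hem : e < m) (hch : A (v 0) (v (2 * e)))
    (hlong : 2 * m < 3 * e + 4 ∨ 2 * m < 3 * (m - e) + 4) :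
    ∃ r F, 2 * m < 3 * r + 4 ∧ AntipathFrom A false (v (2 * e)) F ∧
      r + 1 ≤ (F ∩ h.sources).card ∧ r ≤ (F ∩ h.sinks).card := by
  have hm : 0 < m := by omega
  rcases hlong with hlong | hlong
  · refine ⟨e, insert (v (2 * e)) ((Finset.Icc 0 (0 + (2 * e - 1))).image v), hlong, ?_, ?_, ?_⟩
    · refine .sink (h.antipathFrom_ascending (2 * e - 1) 0 (by omega)) ?_ hch
      intro hmem
      obtain ⟨j, hj, hje⟩ := Finset.mem_image.1 hmem
      rw [Finset.mem_Icc] at hj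
      rw [h.inj, Nat.mod_eq_of_lt (by omega), Nat.mod_eq_of_lt (by omega)] at hje
      omega
    · refine (h.card_image_two_mul_add 0 0 (e + 1) (by omega)).ge.trans (Finset.card_le_card fun w hw => ?_)
      obtain ⟨i, hi, rfl⟩ := Finset.mem_image.1 hw
      rw [Finset.mem_Ico] at hi
      refine Finset.mem_inter.2 ⟨?_, h.two_mul_mem_sources hm i⟩
      rcases eq_or_ne i e with rfl | hie
      · exact Finset.mem_insert_self _ _
      · refine Finset.mem_insert_of_mem (Finset.mem_image_of_mem v ?_)
        rw [Finset.mem_Icc]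
        omega
    · refine (h.card_image_two_mul_add 1 0 e (by omega)).ge.trans (Finset.card_le_card fun w hw => ?_)
      obtain ⟨i, hi, rfl⟩ := Finset.mem_image.1 hw
      rw [Finset.mem_Ico] at hi
      refine Finset.mem_inter.2 ⟨?_, h.two_mul_add_one_mem_sinks hm i⟩
      refine Finset.mem_insert_of_mem (Finset.mem_image_of_mem v ?_)
      rw [Finset.mem_Icc]
      omega
  · refine ⟨m - e, insert (v (2 * e))
      ((Finset.Icc (2 * e + 1) (2 * e + 1 + (2 * m - 2 * e - 1))).image v), hlong, ?_, ?_, ?_⟩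
    · have h1 := h.antipathFrom_descending (2 * e + 1) (2 * m - 2 * e - 1) (by omega)
      have h2 : 2 * e + 1 + (2 * m - 2 * e - 1) = 2 * m := by omega
      have h3 : v (2 * m) = v 0 := (h.inj _ _).2 (by simp)
      rw [h2, h3, show decide (2 * m % 2 = 0) = true by simp] at h1
      rw [h2]
      refine .sink h1 ?_ hch
      intro hmem
      obtain ⟨j, hj, hje⟩ := Finset.mem_image.1 hmem
      rw [Finset.mem_Icc] at hj
      have := h.injOn_Icc (2 * e) (2 * m - 2 * e) (by omega) (by simp; omega) (by simp) hje
      omega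
    · refine (h.card_image_two_mul_add 0 e (m - e + 1) (by omega)).ge.trans (Finset.card_le_card fun w hw => ?_)
      obtain ⟨i, hi, rfl⟩ := Finset.mem_image.1 hw
      rw [Finset.mem_Ico] at hi
      refine Finset.mem_inter.2 ⟨?_, h.two_mul_mem_sources hm i⟩
      rcases eq_or_ne i e with rfl | hie
      · exact Finset.mem_insert_self _ _
      · refine Finset.mem_insert_of_mem (Finset.mem_image_of_mem v ?_)
        rw [Finset.mem_Icc]
        omega
    · refine (h.card_image_two_mul_add 1 e (m - e) (by omega)).ge.trans (Finset.card_le_card fun w hw => ?_)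
      obtain ⟨i, hi, rfl⟩ := Finset.mem_image.1 hw
      rw [Finset.mem_Ico] at hi
      refine Finset.mem_inter.2 ⟨?_, h.two_mul_add_one_mem_sinks hm i⟩
      refine Finset.mem_insert_of_mem (Finset.mem_image_of_mem v ?_)
      rw [Finset.mem_Icc]
      omega

end IsUnrolledAnticycle

open Classical in
theorem PseudoSemiDegreeAtLeast.le_card {V : Type*} [Fintype V] {A : V → V → Prop} {k : ℕ}
    (h : PseudoSemiDegreeAtLeast A ((2 * (k : ℚ) + 1) / 3)) :
    (∀ v w, A v w → 2 * k + 1 ≤ 3 * (Finset.univ.filter fun w => A v w).card) ∧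
      ∀ v w, A w v → 2 * k + 1 ≤ 3 * (Finset.univ.filter fun w => A w v).card := by
  have ho (v : V) : outDeg A v = (Finset.univ.filter fun w => A v w).card := by
    rw [outDeg, ← Set.ncard_coe_finset]
    simp
  have hi (v : V) : inDeg A v = (Finset.univ.filter fun w => A w v).card := by
    rw [inDeg, ← Set.ncard_coe_finset]
    simp
  refine ⟨fun v w hvw => ?_, fun v w hvw => ?_⟩
  · have := (h v).1 (by rw [ho]; exact Finset.card_pos.2 ⟨w, by simpa using hvw⟩)
    rw [div_le_iff₀ (by norm_num), ho, mul_comm _ (3 : ℚ)] at this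
    exact_mod_cast this
  · have := (h v).2 (by rw [hi]; exact Finset.card_pos.2 ⟨w, by simpa using hvw⟩)
    rw [div_le_iff₀ (by norm_num), hi, mul_comm _ (3 : ℚ)] at this
    exact_mod_cast this

/-- Let `k ≥ 4` and let `D` be a finite oriented graph with minimum pseudo-semi-degree
`δ̃⁰(D) ≥ (2k+1)/3`.  If `D` contains an anti-directed cycle of length `s ≤ k`, then
`D` contains an anti-directed path of length at least `s`. -/
theorem antipath_ge_anticycle_length
    {V : Type*} [Fintype V] (A : V → V → Prop) (hA : IsOriented A)
    (k : ℕ) (hk : 4 ≤ k)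
    (hdeg : PseudoSemiDegreeAtLeast A ((2 * (k : ℚ) + 1) / 3))
    (s : ℕ) (hC : HasAnticycle A s) (hsk : s ≤ k) :
    ∃ ℓ, s ≤ ℓ ∧ HasAntipath A ℓ := by
  classical
  obtain ⟨m, v, rfl, hm, h⟩ := hC.exists_unrolled hA
  by_contra! hcon
  have hmax (b : Bool) (z : V) (F : Finset V) (hF : AntipathFrom A b z F) : F.card ≤ 2 * m := by
    by_contra! hlt
    exact hcon _ (by omega) hF.hasAntipath
  obtain ⟨hdout, hdin⟩ := hdeg.le_card
  have hm0 : 0 < m := by omega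
  obtain ⟨e, he, hem, hch, hlong⟩ := h.exists_chord hm hA
    (h.outNeighbor_mem hm0 hmax (h.two_mul_mem_sources hm0 0))
    (by have := hdout _ _ (h.even 0); simp only [mul_zero] at this; omega)
  obtain ⟨r, F, hr, hF, hFS, hFT⟩ := h.exists_antipathFrom_of_chord he hem hch hlong
  obtain ⟨b, z, F', hF', hc⟩ := exists_antipathFrom_card_ge hA (d := (4 * m + 3) / 3)
    h.card_sources_union_sinks h.disjoint_sources_sinks hFS hFT (by omega)
    (fun _ ha => h.outNeighbor_mem hm0 hmax ha) (fun _ ha => h.inNeighbor_mem hm0 hmax ha)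
    (fun v w hvw => by have := hdout v w hvw; omega)
    (fun v w hvw => by have := hdin v w hvw; omega)
    (fun a ha => by
      obtain ⟨i, -, rfl⟩ := h.exists_of_mem_sources ha
      exact ⟨_, h.even i⟩)
    (fun a ha => by
      obtain ⟨i, -, rfl⟩ := h.exists_of_mem_sinks ha
      exact ⟨_, h.even i⟩)
    hF (Finset.disjoint_left.1 h.disjoint_sources_sinks (h.two_mul_mem_sources hm0 e)) ⟨_, hch⟩
    (2 * m + 1) le_rfl
  have := hmax _ _ _ hF'
  omega
end

section
/- Let k ≥ 4 be an integer and let D be a finite oriented graph with minimum pseudo-semi-degree δ̃⁰(D) ≥ (2k+1)/3. If D contains at least one anti-directed path and every anti-directed path in D has length at most k, then the maximum length of an anti-directed path in D is odd. -/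
namespace Antipath

open Finset
open scoped Classical

variable {V : Type*} {A : V → V → Prop} {m d : ℕ} {O I : Finset V}

theorem exists_few_outNeighbours (hA : IsOriented A) {S : Finset V} (hS : S.Nonempty) :
    ∃ x ∈ S, 2 * #{u ∈ S | A x u} + 1 ≤ #S := by
  by_contra! hcon
  have hsum : ∑ x ∈ S, #{u ∈ S | A x u} = ∑ x ∈ S, #{u ∈ S | A u x} :=
    sum_card_bipartiteAbove_eq_sum_card_bipartiteBelow A
  have hlt : ∑ x ∈ S, (#{u ∈ S | A x u} + #{u ∈ S | A u x}) < ∑ _x ∈ S, #S := by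
    refine sum_lt_sum_of_nonempty hS fun x hx => ?_
    have hdisj : Disjoint {u ∈ S | A x u} {u ∈ S | A u x} :=
      disjoint_filter.2 fun u _ h => hA.2 x u h
    rw [← card_union_of_disjoint hdisj]
    refine card_lt_card ⟨union_subset (filter_subset _ _) (filter_subset _ _), fun h => ?_⟩
    have := h hx
    simp [hA.1 x] at this
  have hge : ∑ _x ∈ S, #S ≤ ∑ x ∈ S, 2 * #{u ∈ S | A x u} :=
    sum_le_sum fun x hx => by have := hcon x hx; omega
  rw [sum_add_distrib, ← hsum] at hlt
  rw [← mul_sum] at hge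
  omega

theorem exists_many_outNeighbours [Fintype V] (hA : IsOriented A) {R S : Finset V}
    (hS : S.Nonempty) (hSR : S ⊆ R) (hdeg : ∀ x ∈ S, d ≤ #{u | A x u})
    (hout : ∀ x ∈ S, ∀ u, A x u → u ∈ R ∪ I) :
    ∃ x ∈ S, 2 * d + #S + 1 ≤ 2 * #R + 2 * #{u ∈ I | A x u} := by
  obtain ⟨x, hx, hfew⟩ := exists_few_outNeighbours hA hS
  refine ⟨x, hx, ?_⟩
  have hsub : ({u | A x u} : Finset V) ⊆ ((R \ S) ∪ {u ∈ S | A x u}) ∪ {u ∈ I | A x u} := by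
    intro u hu
    have hu' : A x u := by simpa using hu
    have := hout x hx u hu'
    simp only [mem_union, mem_sdiff, mem_filter] at this ⊢
    tauto
  have h1 := (card_le_card hsub).trans (card_union_le _ _)
  have h2 := card_union_le (R \ S) {u ∈ S | A x u}
  have h3 := card_sdiff_add_card_eq_card hSR
  have h4 := hdeg x hx
  omega

/-- The antipath `o 0 → q 0 ← o 1 → q 1 ← ⋯ → q (m - 1) ← o m`, with out-vertices `O` and
in-vertices `I`. -/
structure IsOutPath (A : V → V → Prop) (m : ℕ) (o q : ℕ → V) (O I : Finset V) : Prop where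
  image_out : (range (m + 1)).image o = O
  image_in : (range m).image q = I
  card_out : #O = m + 1
  card_in : #I = m
  disjoint : Disjoint O I
  arc : ∀ i < m, A (o i) (q i)
  arc_succ : ∀ i < m, A (o (i + 1)) (q i)

/-- There is an antipath with `m + 1` out-vertices and `m + 1` in-vertices. -/
def HasBalancedPath (A : V → V → Prop) (m : ℕ) : Prop :=
  ∃ o q : ℕ → V, Set.InjOn o (Set.Iic m) ∧ Set.InjOn q (Set.Iic m) ∧
    (∀ i ≤ m, ∀ j ≤ m, o i ≠ q j) ∧ (∀ i ≤ m, A (o i) (q i)) ∧ ∀ i < m, A (o (i + 1)) (q i)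

/-- The anticycle `q i ← c i → q (i + 1)`, with out-vertices `O` and in-vertices `I`. -/
structure IsCycle (A : V → V → Prop) (c q : ZMod m → V) (O I : Finset V) : Prop where
  inj_out : Function.Injective c
  inj_in : Function.Injective q
  range_out : Set.range c = O
  range_in : Set.range q = I
  arc : ∀ i, A (c i) (q i)
  arc_succ : ∀ i, A (c i) (q (i + 1))

/-- The vertices of `O` that dominate a vertex of `I` and are left out by an anticycle on the
rest of `O ∪ I`. -/
noncomputable def leftOut (A : V → V → Prop) (m : ℕ) (O I : Finset V) : Finset V :=
  {l ∈ O | (∃ i ∈ I, A l i) ∧ ∃ c q : ZMod m → V, IsCycle A c q (O.erase l) I}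

theorem mem_leftOut {l : V} : l ∈ leftOut A m O I ↔ l ∈ O ∧ (∃ i ∈ I, A l i) ∧
    ∃ c q : ZMod m → V, IsCycle A c q (O.erase l) I := by
  rw [leftOut, mem_filter]

namespace IsOutPath

variable {o q : ℕ → V}

theorem injOn_out (h : IsOutPath A m o q O I) : Set.InjOn o (Set.Iic m) := by
  have : #((range (m + 1)).image o) = #(range (m + 1)) := by
    rw [h.image_out, h.card_out, card_range]
  have := card_image_iff.1 this
  intro i hi j hj
  simp only [Set.mem_Iic] at hi hj
  exact this (by simpa using by omega) (by simpa using by omega)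

theorem injOn_in (h : IsOutPath A m o q O I) : Set.InjOn q (Set.Iio m) := by
  have : #((range m).image q) = #(range m) := by rw [h.image_in, h.card_in, card_range]
  simpa using card_image_iff.1 this

theorem mem_out (h : IsOutPath A m o q O I) {i : ℕ} (hi : i ≤ m) : o i ∈ O := by
  rw [← h.image_out]
  exact mem_image_of_mem _ (by simpa using by omega)

theorem mem_in (h : IsOutPath A m o q O I) {i : ℕ} (hi : i < m) : q i ∈ I := by
  rw [← h.image_in]
  exact mem_image_of_mem _ (by simpa using hi)

theorem reindex (h : IsOutPath A m o q O I) {σ τ : ℕ → ℕ} (hσ : ∀ i ≤ m, σ i ≤ m)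
    (hσ' : ∀ i ≤ m, ∀ j ≤ m, σ i = σ j → i = j) (hτ : ∀ i < m, τ i < m)
    (hτ' : ∀ i < m, ∀ j < m, τ i = τ j → i = j)
    (harc : ∀ i < m, A (o (σ i)) (q (τ i))) (harc' : ∀ i < m, A (o (σ (i + 1))) (q (τ i))) :
    IsOutPath A m (fun i => o (σ i)) (fun i => q (τ i)) O I where
  image_out := by
    refine eq_of_subset_of_card_le ?_ ?_
    · refine image_subset_iff.2 fun i hi => h.mem_out (hσ i ?_)
      simp only [mem_range] at hi; omega
    · rw [card_image_of_injOn, card_range, h.card_out]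
      intro i hi j hj hij
      simp only [coe_range, Set.mem_Iio] at hi hj
      exact hσ' i (by omega) j (by omega)
        (h.injOn_out (hσ i (by omega)) (hσ j (by omega)) hij)
  image_in := by
    refine eq_of_subset_of_card_le ?_ ?_
    · exact image_subset_iff.2 fun i hi => h.mem_in (hτ i (by simpa using hi))
    · rw [card_image_of_injOn, card_range, h.card_in]
      intro i hi j hj hij
      simp only [coe_range, Set.mem_Iio] at hi hj
      exact hτ' i hi j hj (h.injOn_in (hτ i hi) (hτ j hj) hij)
  card_out := h.card_out
  card_in := h.card_in
  disjoint := h.disjoint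
  arc := harc
  arc_succ := harc'

theorem reverse (h : IsOutPath A m o q O I) :
    IsOutPath A m (fun i => o (m - i)) (fun i => q (m - 1 - i)) O I := by
  refine h.reindex (σ := fun i => m - i) (τ := fun i => m - 1 - i) ?_ ?_ ?_ ?_ ?_ ?_
  · intros; omega
  · intros; omega
  · intros; omega
  · intros; omega
  · intro i hi
    have := h.arc_succ (m - 1 - i) (by omega)
    rwa [show m - 1 - i + 1 = m - i by omega] at this
  · intro i hi
    have := h.arc (m - 1 - i) (by omega)
    rwa [show m - (i + 1) = m - 1 - i by omega]

theorem rotate (h : IsOutPath A m o q O I) {j : ℕ} (hj : j < m) (hA : A (o 0) (q j)) :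
    ∃ o' q', IsOutPath A m o' q' O I ∧ o' 0 = o j ∧ o' m = o m := by
  refine ⟨_, _, h.reindex (σ := fun i => if i ≤ j then j - i else i)
    (τ := fun i => if i < j then j - 1 - i else i) ?_ ?_ ?_ ?_ ?_ ?_, ?_, ?_⟩
  · intro i hi; split_ifs <;> omega
  · intro i hi i' hi'; split_ifs <;> omega
  · intro i hi; split_ifs <;> omega
  · intro i hi i' hi'; split_ifs <;> omega
  · intro i hi
    rcases lt_trichotomy i j with hij | rfl | hij
    · rw [if_pos hij.le, if_pos hij]
      have := h.arc_succ (j - 1 - i) (by omega)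
      rwa [show j - 1 - i + 1 = j - i by omega] at this
    · simpa using hA
    · rw [if_neg (by omega), if_neg (by omega)]
      exact h.arc i hi
  · intro i hi
    rcases lt_or_ge i j with hij | hij
    · rw [if_pos (by omega), if_pos hij, show j - (i + 1) = j - 1 - i by omega]
      exact h.arc _ (by omega)
    · rw [if_neg (by omega), if_neg (by omega)]
      exact h.arc_succ i hi
  · simp
  · rw [if_neg (by omega)]

theorem mem_of_arc (h : IsOutPath A m o q O I) (hmax : ¬ HasBalancedPath A m) {x : V}
    (hx : A (o 0) x) : x ∈ O ∪ I := by
  by_contra hxOI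
  simp only [mem_union, not_or] at hxOI
  have hr := h.reverse
  refine hmax ⟨_, fun i => if i < m then q (m - 1 - i) else x, hr.injOn_out, ?_, ?_, ?_, ?_⟩
  · intro i hi j hj hij
    simp only [Set.mem_Iic] at hi hj
    dsimp only at hij
    split_ifs at hij with h1 h2 h2
    · exact hr.injOn_in h1 h2 hij
    · exact absurd (hij ▸ hr.mem_in h1) hxOI.2
    · exact absurd (hij ▸ hr.mem_in h2) hxOI.2
    · omega
  · intro i hi j hj hij
    dsimp only at hij
    have hO : o (m - i) ∈ O := hr.mem_out hi
    split_ifs at hij with h1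
    · exact disjoint_left.1 h.disjoint hO (hij ▸ hr.mem_in h1)
    · exact hxOI.1 (hij ▸ hO)
  · intro i hi
    dsimp only
    split_ifs with h1
    · exact hr.arc i h1
    · rwa [show m - i = 0 by omega]
  · intro i hi
    dsimp only
    rw [if_pos hi]
    exact hr.arc_succ i hi

theorem mem_leftOut_of_closed (h : IsOutPath A m o q O I) (hm : 0 < m) (hA : A (o m) (q 0)) :
    o 0 ∈ leftOut A m O I := by
  have : NeZero m := ⟨hm.ne'⟩
  refine mem_leftOut.2 ⟨h.mem_out (Nat.zero_le _), ⟨q 0, h.mem_in hm, h.arc 0 hm⟩,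
    fun i => o (i.val + 1), fun i => q i.val, ?_⟩
  have hinj : Function.Injective fun i : ZMod m => o (i.val + 1) := by
    intro i j hij
    have hi := ZMod.val_lt i
    have hj := ZMod.val_lt j
    have := h.injOn_out (show i.val + 1 ≤ m by omega) (show j.val + 1 ≤ m by omega) hij
    exact ZMod.val_injective m (by omega)
  have hinj' : Function.Injective fun i : ZMod m => q i.val := fun i j hij =>
    ZMod.val_injective m (h.injOn_in (ZMod.val_lt i) (ZMod.val_lt j) hij)
  refine ⟨hinj, hinj', ?_, ?_, ?_, ?_⟩
  · ext v
    simp only [Set.mem_range, coe_erase, Set.mem_sdiff, mem_coe, Set.mem_singleton_iff]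
    constructor
    · rintro ⟨i, rfl⟩
      have hi := ZMod.val_lt i
      refine ⟨h.mem_out (by omega), fun h0 => ?_⟩
      have := h.injOn_out (show i.val + 1 ≤ m by omega) (show 0 ≤ m by omega) h0
      omega
    · rintro ⟨hv, hne⟩
      rw [← h.image_out] at hv
      obtain ⟨i, hi, rfl⟩ := mem_image.1 hv
      rw [mem_range] at hi
      rcases i with _ | i
      · exact absurd rfl hne
      · exact ⟨(i : ZMod m), by rw [ZMod.val_cast_of_lt (by omega)]⟩
  · ext v
    simp only [Set.mem_range, mem_coe]
    constructor
    · rintro ⟨i, rfl⟩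
      exact h.mem_in (ZMod.val_lt i)
    · intro hv
      rw [← h.image_in] at hv
      obtain ⟨i, hi, rfl⟩ := mem_image.1 hv
      rw [mem_range] at hi
      exact ⟨(i : ZMod m), by rw [ZMod.val_cast_of_lt hi]⟩
  · exact fun i => h.arc_succ _ (ZMod.val_lt i)
  · intro i
    have hi := ZMod.val_lt i
    rcases Nat.lt_or_ge (i.val + 1) m with hlt | hge
    · have : (i + 1).val = i.val + 1 := by
        have : ((i.val + 1 : ℕ) : ZMod m) = i + 1 := by simp
        rw [← this, ZMod.val_cast_of_lt hlt]
      rw [this]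
      exact h.arc _ hlt
    · have h1 : i.val + 1 = m := by omega
      have : i + 1 = 0 := by
        have : ((i.val + 1 : ℕ) : ZMod m) = i + 1 := by simp
        rw [← this, h1, ZMod.natCast_self]
      rw [this, h1, ZMod.val_zero]
      exact hA

theorem mem_leftOut_of_arc_last (h : IsOutPath A m o q O I) (hm : 0 < m)
    (hA : A (o 0) (q (m - 1))) : o m ∈ leftOut A m O I := by
  simpa using h.reverse.mem_leftOut_of_closed hm (by simpa using hA)

theorem mem_leftOut_of_crossing (h : IsOutPath A m o q O I) {j : ℕ} (hj : 0 < j) (hjm : j < m)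
    (hA : A (o 0) (q j)) (hA' : A (o m) (q (j - 1))) : o j ∈ leftOut A m O I := by
  have hp := h.reindex (σ := fun i => if i ≤ m - j then j + i else m - i)
    (τ := fun i => if i < m - j then j + i else m - 1 - i) ?_ ?_ ?_ ?_ ?_ ?_
  · have := hp.mem_leftOut_of_closed (by omega) ?_
    · simpa using this
    · rw [if_neg (by omega), if_pos (by omega)]
      simpa using hA
  · intro i hi; split_ifs <;> omega
  · intro i hi i' hi'; split_ifs <;> omega
  · intro i hi; split_ifs <;> omega
  · intro i hi i' hi'; split_ifs <;> omega
  · intro i hi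
    rcases lt_trichotomy i (m - j) with hij | rfl | hij
    · rw [if_pos hij.le, if_pos hij]
      exact h.arc _ (by omega)
    · rw [if_pos le_rfl, if_neg (lt_irrefl _), show j + (m - j) = m by omega,
        show m - 1 - (m - j) = j - 1 by omega]
      exact hA'
    · rw [if_neg (by omega), if_neg (by omega), show m - i = m - 1 - i + 1 by omega]
      exact h.arc_succ _ (by omega)
  · intro i hi
    rcases lt_or_ge i (m - j) with hij | hij
    · rw [if_pos (by omega), if_pos hij]
      exact h.arc_succ (j + i) (by omega)
    · rw [if_neg (by omega), if_neg (by omega), show m - (i + 1) = m - 1 - i by omega]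
      exact h.arc _ (by omega)

theorem card_filter_in (h : IsOutPath A m o q O I) (v : V) :
    #{j ∈ range m | A v (q j)} = #{u ∈ I | A v u} := by
  rw [← h.image_in, filter_image, card_image_of_injOn]
  refine h.injOn_in.mono fun i hi => ?_
  simp at hi
  exact hi.1

theorem card_add_card_le (h : IsOutPath A m o q O I) :
    #{u ∈ I | A (o 0) u} + #{u ∈ I | A (o m) u} ≤
      m + 1 + #((leftOut A m O I).erase (o 0)) := by
  rw [← h.card_filter_in, ← h.card_filter_in]
  set a := ({j ∈ range m | A (o 0) (q j)}).erase 0 with ha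
  set b := ({j ∈ range m | A (o m) (q j)}).image (· + 1) with hb
  have hca : #{j ∈ range m | A (o 0) (q j)} ≤ #a + 1 := by
    have : _ ≤ #a := pred_card_le_card_erase
    omega
  have hcb : #b = #{j ∈ range m | A (o m) (q j)} :=
    card_image_of_injective _ (add_left_injective 1)
  have hab : #(a ∪ b) ≤ m := by
    have : a ∪ b ⊆ Icc 1 m := by
      intro j hj
      simp only [ha, hb, mem_union, mem_erase, mem_filter, mem_range, mem_image] at hj
      rw [mem_Icc]
      rcases hj with hj | ⟨i, hi, rfl⟩ <;> omega
    simpa using card_le_card this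
  have hinter : #(a ∩ b) ≤ #((leftOut A m O I).erase (o 0)) := by
    have hlt : ∀ j ∈ a ∩ b, 0 < j ∧ j < m ∧ A (o 0) (q j) ∧ A (o m) (q (j - 1)) := by
      intro j hj
      simp only [ha, hb, mem_inter, mem_erase, mem_filter, mem_range, mem_image] at hj
      obtain ⟨⟨h0, hjm, h1⟩, i, ⟨_, h2⟩, rfl⟩ := hj
      exact ⟨by omega, hjm, h1, h2⟩
    refine card_le_card_of_injOn o (fun j hj => ?_) fun i hi j hj hij => ?_
    · obtain ⟨h0, hjm, h1, h2⟩ := hlt j hj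
      refine mem_erase.2 ⟨fun h3 => ?_, h.mem_leftOut_of_crossing h0 hjm h1 h2⟩
      exact h0.ne' (h.injOn_out hjm.le (Nat.zero_le _) h3)
    · exact h.injOn_out (hlt i hi).2.1.le (hlt j hj).2.1.le hij
  have := card_union_add_card_inter a b
  omega

end IsOutPath

theorem natCast_injOn (m : ℕ) : Set.InjOn (Nat.cast : ℕ → ZMod m) (Set.Iio m) := by
  intro a ha b hb hab
  rwa [ZMod.natCast_eq_natCast_iff', Nat.mod_eq_of_lt ha, Nat.mod_eq_of_lt hb] at hab

/-- The sequence `v, f r, f (r + 1), …`. -/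
def cycleCons (v : V) (f : ZMod m → V) (r : ZMod m) (i : ℕ) : V :=
  if i = 0 then v else f (r + (i - 1 : ℕ))

@[simp]
theorem cycleCons_zero (v : V) (f : ZMod m → V) (r : ZMod m) : cycleCons v f r 0 = v := rfl

@[simp]
theorem cycleCons_succ (v : V) (f : ZMod m → V) (r : ZMod m) (i : ℕ) :
    cycleCons v f r (i + 1) = f (r + i) := rfl

theorem injOn_cycleCons {v : V} {f : ZMod m → V} (hf : Function.Injective f)
    (hv : ∀ i, f i ≠ v) (r : ZMod m) : Set.InjOn (cycleCons v f r) (Set.Iic m) := by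
  rintro (_ | i) hi (_ | j) hj hij
  · rfl
  · exact absurd hij.symm (hv _)
  · exact absurd hij (hv _)
  · have := natCast_injOn m (Nat.lt_of_succ_le hi) (Nat.lt_of_succ_le hj)
      (add_left_cancel (hf hij))
    rw [this]

namespace IsCycle

variable {c q : ZMod m → V} {w : V}

theorem mem_out (h : IsCycle A c q O I) (i : ZMod m) : c i ∈ O := by
  rw [← mem_coe, ← h.range_out]
  exact Set.mem_range_self i

theorem mem_in (h : IsCycle A c q O I) (i : ZMod m) : q i ∈ I := by
  rw [← mem_coe, ← h.range_in]
  exact Set.mem_range_self i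

theorem exists_out (h : IsCycle A c q O I) {v : V} (hv : v ∈ O) : ∃ i, c i = v := by
  rwa [← mem_coe, ← h.range_out] at hv

theorem exists_in (h : IsCycle A c q O I) {v : V} (hv : v ∈ I) : ∃ i, q i = v := by
  rwa [← mem_coe, ← h.range_in] at hv

theorem card_out [NeZero m] (h : IsCycle A c q O I) : #O = m := by
  have : univ.image c = O := by rw [← coe_inj]; simpa using h.range_out
  rw [← this, card_image_of_injective _ h.inj_out, card_univ, ZMod.card]

theorem card_filter_in [NeZero m] (h : IsCycle A c q O I) (v : V) :
    #{i | A v (q i)} = #{u ∈ I | A v u} := by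
  have : univ.image q = I := by rw [← coe_inj]; simpa using h.range_in
  rw [← this, filter_image, card_image_of_injective _ h.inj_in]

theorem card_in [NeZero m] (h : IsCycle A c q O I) : #I = m := by
  have : univ.image q = I := by rw [← coe_inj]; simpa using h.range_in
  rw [← this, card_image_of_injective _ h.inj_in, card_univ, ZMod.card]

theorem reverse (h : IsCycle A c q O I) :
    IsCycle A (fun i => c (-i)) (fun i => q (1 - i)) O I where
  inj_out := h.inj_out.comp neg_injective
  inj_in := h.inj_in.comp sub_right_injective
  range_out := by rw [← h.range_out]; exact neg_surjective.range_comp c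
  range_in := by rw [← h.range_in]; exact (Equiv.subLeft (1 : ZMod m)).surjective.range_comp q
  arc i := by
    have := h.arc_succ (-i)
    rwa [neg_add_eq_sub] at this
  arc_succ i := by
    have := h.arc (-i)
    rwa [show 1 - (i + 1) = -i by ring]

theorem exists_isOutPath [NeZero m] (h : IsCycle A c q (O.erase w) I) (hw : w ∈ O)
    (hOI : Disjoint O I) {r : ZMod m} (hr : A w (q r)) :
    ∃ o q', IsOutPath A m o q' O I ∧ o 0 = w ∧ o m = c (r - 1) := by
  refine ⟨cycleCons w c r, fun i => q (r + i), ⟨?_, ?_, ?_, h.card_in, hOI, ?_, ?_⟩, rfl, ?_⟩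
  · ext v
    simp only [mem_image, mem_range]
    constructor
    · rintro ⟨_ | i, -, rfl⟩
      · exact hw
      · exact mem_of_mem_erase (h.mem_out _)
    · intro hv
      by_cases hvw : v = w
      · exact ⟨0, by omega, hvw.symm⟩
      · obtain ⟨i, rfl⟩ := h.exists_out (mem_erase.2 ⟨hvw, hv⟩)
        exact ⟨(i - r).val + 1, by have := ZMod.val_lt (i - r); omega, by simp⟩
  · ext v
    simp only [mem_image, mem_range]
    constructor
    · rintro ⟨i, -, rfl⟩
      exact h.mem_in _
    · intro hv
      obtain ⟨i, rfl⟩ := h.exists_in hv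
      exact ⟨(i - r).val, ZMod.val_lt _, by simp⟩
  · rw [← card_erase_add_one hw, h.card_out]
  · rintro (_ | i) -
    · simpa using hr
    · have := h.arc_succ (r + i)
      simpa [add_assoc] using this
  · exact fun i _ => h.arc _
  · obtain ⟨n, rfl⟩ := Nat.exists_eq_succ_of_ne_zero (NeZero.ne m)
    have : ((n + 1 : ℕ) : ZMod (n + 1)) = 0 := ZMod.natCast_self _
    refine (cycleCons_succ _ _ _ _).trans (congrArg c ?_)
    push_cast at this
    linear_combination this

theorem exists_isOutPath' [NeZero m] (h : IsCycle A c q (O.erase w) I) (hw : w ∈ O)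
    (hOI : Disjoint O I) {r : ZMod m} (hr : A w (q r)) :
    ∃ o q', IsOutPath A m o q' O I ∧ o 0 = w ∧ o m = c r := by
  obtain ⟨o, q', hp, h0, hm⟩ := h.reverse.exists_isOutPath hw hOI (r := 1 - r) (by simpa using hr)
  exact ⟨o, q', hp, h0, by simpa using hm⟩

theorem mem_leftOut_of_arc_arc (h : IsCycle A c q (O.erase w) I) (hw : w ∈ O) {i : ZMod m}
    (hi : A w (q i)) (hi' : A w (q (i + 1))) : c i ∈ leftOut A m O I := by
  have hci := mem_erase.1 (h.mem_out i)
  refine mem_leftOut.2 ⟨hci.2, ⟨q i, h.mem_in i, h.arc i⟩, Function.update c i w, q, ?_⟩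
  refine ⟨?_, h.inj_in, ?_, h.range_in, ?_, ?_⟩
  · intro j l hjl
    have hne : ∀ j, c j ≠ w := fun j => (mem_erase.1 (h.mem_out j)).1
    simp only [Function.update_apply] at hjl
    split_ifs at hjl with h1 h2 h2
    · rw [h1, h2]
    · exact absurd hjl.symm (hne l)
    · exact absurd hjl (hne j)
    · exact h.inj_out hjl
  · ext v
    simp only [Set.mem_range, mem_coe, mem_erase, Function.update_apply]
    constructor
    · rintro ⟨j, rfl⟩
      split_ifs with hj
      · exact ⟨hci.1.symm, hw⟩
      · exact ⟨fun h' => hj (h.inj_out h'), mem_of_mem_erase (h.mem_out j)⟩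
    · rintro ⟨hv, hvO⟩
      by_cases hvw : v = w
      · exact ⟨i, by simp [hvw]⟩
      · obtain ⟨j, rfl⟩ := h.exists_out (mem_erase.2 ⟨hvw, hvO⟩)
        exact ⟨j, if_neg fun h' => hv (by rw [h'])⟩
  · intro j
    rcases eq_or_ne j i with rfl | hj
    · simpa using hi
    · simpa [Function.update_of_ne hj] using h.arc j
  · intro j
    rcases eq_or_ne j i with rfl | hj
    · simpa using hi'
    · simpa [Function.update_of_ne hj] using h.arc_succ j

theorem mem_of_arc_to (h : IsCycle A c q (O.erase w) I) (hw : w ∈ O) (hOI : Disjoint O I)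
    (hmax : ¬ HasBalancedPath A m) {j : ZMod m} (hj : A (c j) w) {x : V} (hx : A x w)
    (hxw : x ≠ w) : x ∈ O ∪ I := by
  by_contra hxOI
  simp only [mem_union, not_or] at hxOI
  have hcO : ∀ i, c i ∈ O := fun i => mem_of_mem_erase (h.mem_out i)
  refine hmax ⟨cycleCons x c j, cycleCons w q (j + 1), injOn_cycleCons h.inj_out ?_ _,
    injOn_cycleCons h.inj_in ?_ _, ?_, ?_, ?_⟩
  · rintro i rfl
    exact hxOI.1 (hcO i)
  · intro i hi
    exact disjoint_left.1 hOI hw (hi ▸ h.mem_in i)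
  · rintro (_ | i) - (_ | l) -
    · exact hxw
    · intro h'
      exact hxOI.2 ((show x = q (j + 1 + l) from h') ▸ h.mem_in _)
    · exact (mem_erase.1 (h.mem_out _)).1
    · intro h'
      exact disjoint_left.1 hOI (hcO (j + i))
        ((show c (j + i) = q (j + 1 + l) from h') ▸ h.mem_in _)
  · rintro (_ | i) -
    · exact hx
    · have := h.arc_succ (j + i)
      rwa [add_right_comm] at this
  · rintro (_ | i) -
    · simpa using hj
    · have := h.arc (j + 1 + i)
      simpa [add_assoc, add_comm, add_left_comm] using this

end IsCycle

theorem HasBalancedPath.hasAntipath (h : HasBalancedPath A m) : HasAntipath A (2 * m + 1) := by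
  obtain ⟨o, q, ho, hq, hoq, harc, harc'⟩ := h
  refine ⟨fun i => if i.val % 2 = 0 then o (i.val / 2) else q (i.val / 2), ?_, Or.inl ?_⟩
  · intro i j hij
    have hi := i.isLt
    have hj := j.isLt
    dsimp only at hij
    refine Fin.ext ?_
    split_ifs at hij with h1 h2 h2
    · have := ho (show i.val / 2 ≤ m by omega) (show j.val / 2 ≤ m by omega) hij
      omega
    · exact absurd hij (hoq _ (by omega) _ (by omega))
    · exact absurd hij.symm (hoq _ (by omega) _ (by omega))
    · have := hq (show i.val / 2 ≤ m by omega) (show j.val / 2 ≤ m by omega) hij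
      omega
  · intro i
    have hi := i.isLt
    simp only [Fin.val_castSucc, Fin.val_succ]
    split_ifs with h1 h2 h2
    · omega
    · rw [show (i.val + 1) / 2 = i.val / 2 by omega]
      exact harc _ (by omega)
    · rw [show (i.val + 1) / 2 = i.val / 2 + 1 by omega]
      exact harc' _ (by omega)
    · omega

theorem exists_isOutPath {x : Fin (2 * m + 1) → V} (hx : Function.Injective x)
    (harc : ∀ i : Fin (2 * m), if i.val % 2 = 0 then A (x i.castSucc) (x i.succ)
      else A (x i.succ) (x i.castSucc)) : ∃ o q O I, IsOutPath A m o q O I := by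
  let y : ℕ → V := fun n => x (Fin.ofNat _ n)
  have hy : ∀ n (hn : n < 2 * m + 1), y n = x ⟨n, hn⟩ := fun n hn =>
    congrArg x (Fin.ext (Nat.mod_eq_of_lt hn))
  have hyinj : ∀ i j, i < 2 * m + 1 → j < 2 * m + 1 → y i = y j → i = j := by
    intro i j hi hj hij
    rw [hy i hi, hy j hj] at hij
    exact Fin.mk.inj_iff.1 (hx hij)
  refine ⟨fun i => y (2 * i), fun i => y (2 * i + 1), _, _, rfl, rfl, ?_, ?_, ?_, ?_, ?_⟩
  · rw [card_image_of_injOn, card_range]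
    intro i hi j hj hij
    simp only [coe_range, Set.mem_Iio] at hi hj
    have := hyinj _ _ (by omega) (by omega) hij
    omega
  · rw [card_image_of_injOn, card_range]
    intro i hi j hj hij
    simp only [coe_range, Set.mem_Iio] at hi hj
    have := hyinj _ _ (by omega) (by omega) hij
    omega
  · rw [disjoint_left]
    intro v hv hv'
    obtain ⟨i, hi, rfl⟩ := mem_image.1 hv
    obtain ⟨j, hj, hij⟩ := mem_image.1 hv'
    rw [mem_range] at hi hj
    have := hyinj _ _ (by omega) (by omega) hij
    omega
  · intro i hi
    have := harc ⟨2 * i, by omega⟩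
    rw [if_pos (by simp)] at this
    rw [hy _ (by omega), hy _ (by omega)]
    exact this
  · intro i hi
    have := harc ⟨2 * i + 1, by omega⟩
    rw [if_neg (by dsimp only; omega)] at this
    rw [hy _ (by omega), hy _ (by omega)]
    exact this

variable [Fintype V]

theorem not_arc_of_mem_leftOut (hA : IsOriented A) [NeZero m] (hd : m < d)
    (hout : ∀ v u, A v u → d ≤ #{u | A v u}) (hin : ∀ v u, A u v → d ≤ #{u | A u v})
    (hmax : ¬ HasBalancedPath A m) (hOI : Disjoint O I) {w u : V} (hw : w ∈ leftOut A m O I)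
    (hu : u ∈ O) : ¬ A u w := by
  intro huw
  obtain ⟨hwO, ⟨i, hi, hwi⟩, c, q, hc⟩ := mem_leftOut.1 hw
  obtain ⟨r, rfl⟩ := hc.exists_in hi
  obtain ⟨o, q', hp, h0, -⟩ := hc.exists_isOutPath hwO hOI hwi
  have hne : ∀ {x y}, A x y → x ≠ y := fun hxy h' => hA.1 _ (h' ▸ hxy)
  obtain ⟨j, rfl⟩ := hc.exists_out (mem_erase.2 ⟨hne huw, hu⟩)
  have hsub : ({u | A w u} : Finset V) ∪ ({u | A u w} : Finset V) ⊆ O.erase w ∪ I := by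
    intro x hx
    simp only [mem_union, mem_filter, mem_univ, true_and] at hx
    have hx' : x ∈ O ∪ I ∧ x ≠ w := by
      rcases hx with hx | hx
      · exact ⟨hp.mem_of_arc hmax (h0 ▸ hx), (hne hx).symm⟩
      · exact ⟨hc.mem_of_arc_to hwO hOI hmax huw hx (hne hx), hne hx⟩
    simp only [mem_union, mem_erase] at hx' ⊢
    tauto
  have hdisj : Disjoint ({u | A w u} : Finset V) ({u | A u w} : Finset V) :=
    disjoint_filter.2 fun u _ h => hA.2 w u h
  have h1 := (card_le_card hsub).trans (card_union_le _ _)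
  rw [card_union_of_disjoint hdisj, hc.card_out, hc.card_in] at h1
  have h2 := hout w _ hwi
  have h3 := hin w _ huw
  omega

theorem leftOut_eq_empty (hA : IsOriented A) [NeZero m] (hd : 4 * m + 1 ≤ 3 * d)
    (hout : ∀ v u, A v u → d ≤ #{u | A v u}) (hin : ∀ v u, A u v → d ≤ #{u | A u v})
    (hmax : ¬ HasBalancedPath A m) (hOI : Disjoint O I) : leftOut A m O I = ∅ := by
  rw [eq_empty_iff_forall_notMem]
  intro w hw
  have hno : ∀ {x u}, x ∈ leftOut A m O I → u ∈ O → ¬ A u x := fun hx hu =>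
    not_arc_of_mem_leftOut hA (by omega) hout hin hmax hOI hx hu
  obtain ⟨hwO, ⟨i, hi, hwi⟩, c, q, hc⟩ := mem_leftOut.1 hw
  set L := leftOut A m O I with hL
  have hLO : L ⊆ O := fun x hx => (mem_leftOut.1 hx).1
  have hcardO : #O = m + 1 := by rw [← card_erase_add_one hwO, hc.card_out]
  have hcardR := card_sdiff_add_card_eq_card hLO
  have hcardL := card_erase_add_one hw
  have houtR : ∀ {x u}, x ∈ O → u ∈ O ∪ I → A x u → u ∈ (O \ L) ∪ I := by
    intro x u hx hu hxu
    have : u ∉ L := fun h => hno h hx hxu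
    simp only [mem_union, mem_sdiff] at hu ⊢
    tauto
  have ha : d + #L ≤ m + 1 + #{u ∈ I | A w u} := by
    obtain ⟨r, rfl⟩ := hc.exists_in hi
    obtain ⟨o, q', hp, h0, -⟩ := hc.exists_isOutPath hwO hOI hwi
    obtain ⟨x, hx, h⟩ := exists_many_outNeighbours (d := d) (I := I) (R := insert w (O \ L)) (S := {w}) hA
      (singleton_nonempty w) (by simp) (fun x hx => by
        rw [mem_singleton.1 hx]; exact hout _ _ hwi) (fun x hx u hxu => by
        rw [mem_singleton.1 hx] at hxu
        rw [insert_union]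
        exact mem_insert_of_mem (houtR hwO (hp.mem_of_arc hmax (h0 ▸ hxu)) hxu))
    rw [mem_singleton.1 hx, card_singleton] at h
    have := card_insert_le w (O \ L)
    omega
  set J : Finset (ZMod m) := {i | A w (q i)} with hJ
  have hcardJ : #J = #{u ∈ I | A w u} := hc.card_filter_in w
  set X := J.image c ∪ J.image (fun i => c (i - 1)) with hX
  have hXpath : ∀ x ∈ X, x ∈ O.erase w ∧ ∃ o q', IsOutPath A m o q' O I ∧ o 0 = w ∧ o m = x := by
    intro x hx
    simp only [hX, hJ, mem_union, mem_image, mem_filter, mem_univ, true_and] at hx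
    rcases hx with ⟨j, hj, rfl⟩ | ⟨j, hj, rfl⟩
    · exact ⟨hc.mem_out _, hc.exists_isOutPath' hwO hOI hj⟩
    · exact ⟨hc.mem_out _, hc.exists_isOutPath hwO hOI hj⟩
  have hcardX : 2 * #J ≤ #X + #(L.erase w) := by
    have h1 : #(J.image c) = #J := card_image_of_injective _ hc.inj_out
    have h2 : #(J.image (fun i => c (i - 1))) = #J :=
      card_image_of_injective _ (hc.inj_out.comp sub_left_injective)
    have h3 : J.image c ∩ J.image (fun i => c (i - 1)) ⊆ L.erase w := by
      intro x hx
      simp only [hJ, mem_inter, mem_image, mem_filter, mem_univ, true_and] at hx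
      obtain ⟨⟨j, hj, rfl⟩, l, hl, hlj⟩ := hx
      have : l = j + 1 := by rw [← hc.inj_out hlj]; ring
      exact mem_erase.2 ⟨(mem_erase.1 (hc.mem_out j)).1,
        hc.mem_leftOut_of_arc_arc hwO hj (this ▸ hl)⟩
    have h4 := card_le_card h3
    have h5 := card_union_add_card_inter (J.image c) (J.image (fun i => c (i - 1)))
    rw [← hX] at h5
    omega
  have hcardS : #X ≤ #(X \ L) + #(L.erase w) := by
    have h1 : X ∩ L ⊆ L.erase w := fun x hx =>
      mem_erase.2 ⟨(mem_erase.1 (hXpath x (mem_inter.1 hx).1).1).1, (mem_inter.1 hx).2⟩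
    have h2 := card_le_card h1
    have h3 := card_sdiff_add_card_inter X L
    omega
  have hXend : ∀ x ∈ X, x ∈ O ∧ (∃ u, A x u) ∧ ∀ u, A x u → u ∈ O ∪ I := by
    intro x hx
    obtain ⟨hxO, o, q', hp, -, rfl⟩ := hXpath x hx
    have hm := NeZero.pos m
    refine ⟨mem_of_mem_erase hxO, ⟨_, hp.reverse.arc 0 hm⟩, fun u hu => ?_⟩
    exact hp.reverse.mem_of_arc hmax hu
  obtain ⟨x, hx, hb⟩ := exists_many_outNeighbours (d := d) (I := I) (R := O \ L) (S := X \ L) hA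
    (card_pos.1 (by omega)) (sdiff_subset_sdiff (fun x hx => (hXend x hx).1) subset_rfl)
    (fun x hx => by
      obtain ⟨u, hu⟩ := (hXend x (mem_sdiff.1 hx).1).2.1
      exact hout x u hu)
    (fun x hx u hxu => by
      have := hXend x (mem_sdiff.1 hx).1
      exact houtR this.1 (this.2.2 u hxu) hxu)
  obtain ⟨-, o, q', hp, h0, rfl⟩ := hXpath x (mem_sdiff.1 hx).1
  have hab := hp.card_add_card_le
  rw [h0, ← hL] at hab
  omega

theorem not_isOutPath (hA : IsOriented A) (hm : 0 < m) (hd : 4 * m + 1 ≤ 3 * d)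
    (hout : ∀ v u, A v u → d ≤ #{u | A v u}) (hin : ∀ v u, A u v → d ≤ #{u | A u v})
    (hmax : ¬ HasBalancedPath A m) {o q : ℕ → V} : ¬ IsOutPath A m o q O I := by
  intro hp
  have : NeZero m := ⟨hm.ne'⟩
  have hempty : ∀ {o q O I}, IsOutPath A m o q O I → leftOut A m O I = ∅ := fun h =>
    leftOut_eq_empty hA hd hout hin hmax h.disjoint
  have hend : ∀ {o q O I}, IsOutPath A m o q O I →
      d ≤ #{u | A (o 0) u} ∧ ∀ u, A (o 0) u → u ∈ O ∪ I :=
    fun h => ⟨hout _ _ (h.arc 0 hm), fun u hu => h.mem_of_arc hmax hu⟩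
  let P : ℕ → Prop := fun n => ∃ o q O I, IsOutPath A m o q O I ∧
    #{u ∈ I | A (o 0) u} + #{u ∈ I | A (o m) u} = n
  have hbd : ∀ n, P n → n ≤ m + 1 := by
    rintro n ⟨o, q, O, I, h, rfl⟩
    have := h.card_add_card_le
    rwa [hempty h, erase_empty, card_empty, add_zero] at this
  have hP0 : P _ := ⟨o, q, O, I, hp, rfl⟩
  obtain ⟨o, q, O, I, hp, hn⟩ := Nat.findGreatest_spec (hbd _ hP0) hP0
  have hopt : ∀ {o' q' O' I'}, IsOutPath A m o' q' O' I' →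
      #{u ∈ I' | A (o' 0) u} + #{u ∈ I' | A (o' m) u} ≤
        #{u ∈ I | A (o 0) u} + #{u ∈ I | A (o m) u} := by
    intro o' q' O' I' h
    rw [hn]
    have h' : P _ := ⟨o', q', O', I', h, rfl⟩
    exact Nat.le_findGreatest (hbd _ h') h'
  clear hn hP0
  wlog hle : #{u ∈ I | A (o m) u} ≤ #{u ∈ I | A (o 0) u} generalizing o q
  · refine this _ _ hp.reverse (fun h => ?_) ?_
    · have := hopt h
      simp only [Nat.sub_self, Nat.sub_zero]
      omega
    · simp only [Nat.sub_self, Nat.sub_zero]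
      omega
  have hab := hbd _ ⟨o, q, O, I, hp, rfl⟩
  have ha : #{u ∈ I | A (o 0) u} < m := by
    rw [← hp.card_filter_in]
    calc _ < #(range m) := card_lt_card ⟨filter_subset _ _, fun h => ?_⟩
      _ = m := card_range m
    have h1 := (mem_filter.1 (h (mem_range.2 (Nat.sub_lt hm one_pos)))).2
    have h2 := hp.mem_leftOut_of_arc_last hm h1
    simp [hempty hp] at h2
  -- The first vertices of the rotations that keep the last vertex, together with that vertex.
  have hends : ∀ {o q}, IsOutPath A m o q O I →
      ∃ X ⊆ O, o m ∉ X ∧ #X = #{u ∈ I | A (o 0) u} ∧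
        ∀ x ∈ X, ∃ o' q', IsOutPath A m o' q' O I ∧ o' 0 = x ∧ o' m = o m := by
    intro o q h
    have hlt : ∀ j ∈ ({j ∈ range m | A (o 0) (q j)} : Finset ℕ), j < m := fun j hj =>
      mem_range.1 (mem_filter.1 hj).1
    refine ⟨({j ∈ range m | A (o 0) (q j)} : Finset ℕ).image o, ?_, ?_, ?_, ?_⟩
    · exact image_subset_iff.2 fun j hj => h.mem_out (hlt j hj).le
    · intro hmem
      obtain ⟨j, hj, hjm⟩ := mem_image.1 hmem
      exact (hlt j hj).ne (h.injOn_out (hlt j hj).le (Set.mem_Iic.2 le_rfl) hjm)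
    · rw [← h.card_filter_in, card_image_of_injOn]
      exact fun i hi j hj => h.injOn_out (hlt i hi).le (hlt j hj).le
    · intro x hx
      obtain ⟨j, hj, rfl⟩ := mem_image.1 hx
      exact h.rotate (hlt j hj) (mem_filter.1 hj).2
  have ha' : 2 * d ≤ 2 * m + #{u ∈ I | A (o 0) u} := by
    obtain ⟨X, hXO, hmX, hcard, hX⟩ := hends hp
    have hX' : ∀ x ∈ insert (o m) X, d ≤ #{u | A x u} ∧ ∀ u, A x u → u ∈ O ∪ I := by
      intro x hx
      rcases mem_insert.1 hx with rfl | hx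
      · simpa using hend hp.reverse
      · obtain ⟨o', q', h, rfl, -⟩ := hX x hx
        exact hend h
    obtain ⟨x, hx, hxd⟩ := exists_many_outNeighbours hA (insert_nonempty (o m) X)
      (insert_subset (hp.mem_out le_rfl) hXO) (fun x hx => (hX' x hx).1)
      (fun x hx => (hX' x hx).2)
    rw [card_insert_of_notMem hmX, hp.card_out, hcard] at hxd
    rcases mem_insert.1 hx with rfl | hx
    · omega
    · obtain ⟨o', q', h, rfl, hm'⟩ := hX x hx
      have := hopt h
      rw [hm'] at this
      omega
  have hb : 2 * d ≤ 2 * m + 1 + #{u ∈ I | A (o m) u} := by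
    obtain ⟨X, hXO, -, hcard, hX⟩ := hends hp.reverse
    simp only [Nat.sub_self, Nat.sub_zero] at hcard hX
    have hpos : X.Nonempty := by
      rw [← card_pos, hcard, card_pos]
      exact ⟨_, mem_filter.2 ⟨hp.reverse.mem_in hm, by simpa using hp.reverse.arc 0 hm⟩⟩
    have hX' : ∀ x ∈ X, d ≤ #{u | A x u} ∧ ∀ u, A x u → u ∈ O ∪ I := by
      intro x hx
      obtain ⟨o', q', h, rfl, -⟩ := hX x hx
      exact hend h
    obtain ⟨x, hx, hxd⟩ := exists_many_outNeighbours hA hpos hXO (fun x hx => (hX' x hx).1)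
      (fun x hx => (hX' x hx).2)
    rw [hp.card_out, hcard] at hxd
    obtain ⟨o', q', h, rfl, hm'⟩ := hX x hx
    have := hopt h
    rw [hm'] at this
    omega
  omega

theorem not_alternating (hA : IsOriented A) (hm : 0 < m) (hd : 4 * m + 1 ≤ 3 * d)
    (hout : ∀ v u, A v u → d ≤ #{u | A v u}) (hin : ∀ v u, A u v → d ≤ #{u | A u v})
    (hmax : ¬ HasAntipath A (2 * m + 1)) {x : Fin (2 * m + 1) → V} (hx : Function.Injective x) :
    ¬ ∀ i : Fin (2 * m), if i.val % 2 = 0 then A (x i.castSucc) (x i.succ)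
      else A (x i.succ) (x i.castSucc) := by
  intro harc
  obtain ⟨o, q, O, I, hp⟩ := exists_isOutPath hx harc
  exact not_isOutPath hA hm hd hout hin (mt HasBalancedPath.hasAntipath hmax) hp

end Antipath

/-- Let `k ≥ 4` and let `D` be a finite oriented graph with minimum pseudo-semi-degree
`δ̃⁰(D) ≥ (2k+1)/3`.  If `D` contains at least one anti-directed path and every
anti-directed path in `D` has length at most `k`, then the maximum length of an
anti-directed path in `D` is odd. -/
theorem longest_antipath_odd
    {V : Type*} [Fintype V] (A : V → V → Prop) (hA : IsOriented A)
    (k : ℕ) (hk : 4 ≤ k)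
    (hdeg : PseudoSemiDegreeAtLeast A ((2 * (k : ℚ) + 1) / 3))
    (hex : ∃ ℓ, 1 ≤ ℓ ∧ HasAntipath A ℓ)
    (hbd : ∀ ℓ, HasAntipath A ℓ → ℓ ≤ k) :
    ∀ t, HasAntipath A t → (∀ ℓ, HasAntipath A ℓ → ℓ ≤ t) → Odd t := by
  classical
  intro t ht hmax
  by_contra hodd
  obtain ⟨m, hm⟩ := Nat.not_odd_iff_even.1 hodd
  obtain rfl : t = 2 * m := by omega
  clear hm
  obtain ⟨ℓ, hℓ, hℓp⟩ := hex
  have hm : 0 < m := by have := hmax ℓ hℓp; omega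
  have hmk : 2 * m ≤ k := hbd _ ht
  have hlong : ¬ HasAntipath A (2 * m + 1) := fun h => by have := hmax _ h; omega
  obtain ⟨d, hd, hdle⟩ : ∃ d : ℕ, 2 * k + 1 ≤ 3 * d ∧
      ∀ n : ℕ, (2 * (k : ℚ) + 1) / 3 ≤ n → d ≤ n := by
    refine ⟨(2 * k + 3) / 3, by omega, fun n hn => ?_⟩
    rw [div_le_iff₀ (by norm_num)] at hn
    have : 2 * k + 1 ≤ n * 3 := by exact_mod_cast hn
    omega
  have hout : ∀ v u, A v u → d ≤ (Finset.univ.filter fun u => A v u).card := by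
    intro v u huv
    have heq : outDeg A v = (Finset.univ.filter fun u => A v u).card := by
      rw [outDeg, ← Set.ncard_coe_finset]; simp
    rw [← heq]
    refine hdle _ ((hdeg v).1 ?_)
    rw [heq]
    exact Finset.card_pos.2 ⟨u, by simpa using huv⟩
  have hin : ∀ v u, A u v → d ≤ (Finset.univ.filter fun u => A u v).card := by
    intro v u huv
    have heq : inDeg A v = (Finset.univ.filter fun u => A u v).card := by
      rw [inDeg, ← Set.ncard_coe_finset]; simp
    rw [← heq]
    refine hdle _ ((hdeg v).2 ?_)
    rw [heq]
    exact Finset.card_pos.2 ⟨u, by simpa using huv⟩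
  obtain ⟨x, hx, harc | harc⟩ := ht
  · refine Antipath.not_alternating (d := d) hA hm (by omega) (fun v u h => ?_)
      (fun v u h => ?_) hlong hx harc
    · convert hout v u h
    · convert hin v u h
  · refine Antipath.not_alternating (d := d) (A := fun u v => A v u) ⟨hA.1, fun u v h => hA.2 v u h⟩ hm
      (by omega) (fun v u h => ?_) (fun v u h => ?_) ?_ hx harc
    · convert hin v u h
    · convert hout v u h
    · rintro ⟨y, hy, hyarc⟩
      exact hlong ⟨y, hy, hyarc.symm⟩
end

section
/- Let D be a finite oriented graph containing no anti-directed cycle, and let P = x₀x₁⋯x_t be an anti-directed path in D of maximum length among all anti-directed paths in D, with the arc between x₀ and x₁ oriented from x₀ to x₁. If t is odd, then the out-degree of x₀ satisfies d⁺(x₀) ≤ (t+1)/2. -/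
/-- Prepending a new out-neighbour of the initial vertex to an antipath that starts with
a forward arc gives a longer antipath. -/
theorem hasAntipath_succ_of_forward {V : Type*} {A : V → V → Prop} {t : ℕ}
    {x : Fin (t + 1) → V} (hinj : Function.Injective x)
    (hfwd : ∀ i : Fin t, if i.val % 2 = 0 then A (x i.castSucc) (x i.succ)
      else A (x i.succ) (x i.castSucc))
    {v : V} (hv : A (x 0) v) (hvx : v ∉ Set.range x) : HasAntipath A (t + 1) := by
  refine ⟨Fin.cons v x, Fin.cons_injective_iff.2 ⟨hvx, hinj⟩, Or.inr fun i => ?_⟩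
  induction i using Fin.cases with
  | zero => simpa using hv
  | succ k =>
    have h := hfwd k
    rw [← Fin.succ_castSucc, Fin.cons_succ, Fin.cons_succ, Fin.val_succ]
    split_ifs at h ⊢ <;> first | exact h | omega

/-- An antipath with a forward first arc whose initial vertex dominates a vertex at odd
position `n ≥ 3` closes up to an anticycle of length `n + 1`. -/
theorem hasAnticycle_of_forward_of_arc {V : Type*} {A : V → V → Prop} {t : ℕ}
    {x : Fin (t + 1) → V} (hinj : Function.Injective x)
    (hfwd : ∀ i : Fin t, if i.val % 2 = 0 then A (x i.castSucc) (x i.succ)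
      else A (x i.succ) (x i.castSucc))
    {n : ℕ} (hnt : n < t + 1) (hodd : n % 2 = 1) (hn : 3 ≤ n)
    (harc : A (x 0) (x ⟨n, hnt⟩)) : HasAnticycle A (n + 1) := by
  have hstep : ∀ (a b : Fin (t + 1)), b.val = a.val + 1 →
      (a.val % 2 = 0 → A (x a) (x b)) ∧ (a.val % 2 = 1 → A (x b) (x a)) := by
    intro a b hab
    have hat : a.val < t := by omega
    have h := hfwd ⟨a, hat⟩
    have ha : (⟨a, hat⟩ : Fin t).castSucc = a := Fin.ext rfl
    have hb : (⟨a, hat⟩ : Fin t).succ = b := Fin.ext hab.symm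
    rw [ha, hb] at h
    constructor <;> intro hp
    · rwa [if_pos hp] at h
    · rwa [if_neg (show ¬ a.val % 2 = 0 by omega)] at h
  let e : Fin (n + 1) → Fin (t + 1) := Fin.castLE (by omega)
  have hclose : ∀ a b : Fin (n + 1), a.val = 0 → b.val = n → A (x (e a)) (x (e b)) := by
    intro a b ha hb
    have h1 : e a = 0 := Fin.ext ha
    have h2 : e b = ⟨n, hnt⟩ := Fin.ext hb
    rwa [h1, h2]
  have hcyc : ∀ a : Fin (n + 1),
      (A (x (e a)) (x (e (a + 1))) ∧ A (x (e a)) (x (e (a - 1)))) ∨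
        (A (x (e (a + 1))) (x (e a)) ∧ A (x (e (a - 1))) (x (e a))) := by
    intro a
    have hadd : (a + 1).val = if a.val = n then 0 else a.val + 1 := by
      rw [Fin.val_add_one]
      simp only [Fin.ext_iff, Fin.val_last]
    have hsub : (a - 1).val = if a.val = 0 then n else a.val - 1 := by
      rw [Fin.coe_sub_one]
      simp only [Fin.ext_iff, Fin.val_zero]
    have halt := a.isLt
    rcases Nat.mod_two_eq_zero_or_one a.val with hp | hp
    · left
      rw [if_neg (by omega)] at hadd
      refine ⟨(hstep (e a) (e (a + 1)) hadd).1 hp, ?_⟩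
      by_cases h0 : a.val = 0
      · exact hclose _ _ h0 (by rw [hsub, if_pos h0])
      · rw [if_neg h0] at hsub
        exact (hstep (e (a - 1)) (e a) (by simp only [e, Fin.val_castLE]; omega)).2
          (by simp only [e, Fin.val_castLE]; omega)
    · right
      rw [if_neg (by omega)] at hsub
      refine ⟨?_, (hstep (e (a - 1)) (e a) (by simp only [e, Fin.val_castLE]; omega)).1
        (by simp only [e, Fin.val_castLE]; omega)⟩
      by_cases h0 : a.val = n
      · exact hclose _ _ (by rw [hadd, if_pos h0]) h0
      · rw [if_neg h0] at hadd
        exact (hstep (e a) (e (a + 1)) hadd).2 hp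
  exact ⟨by omega, x ∘ e, hinj.comp (Fin.castLE_injective _), hcyc⟩

/-- Let `D` be a finite oriented graph with no anti-directed cycle, and let
`P = x 0, x 1, …, x t` be a longest anti-directed path in `D`, with the arc between
`x 0` and `x 1` oriented from `x 0` to `x 1`.  If `t` is odd, then
`d⁺(x 0) ≤ (t + 1) / 2`. -/
theorem outDeg_le_of_longest_antipath_odd
    {V : Type*} [Fintype V] (A : V → V → Prop) (hA : IsOriented A)
    (hnc : ¬ ∃ ℓ, HasAnticycle A ℓ)
    {t : ℕ} (x : Fin (t + 1) → V) (hx : IsAntipath A x)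
    (hmax : ∀ m, HasAntipath A m → m ≤ t)
    (ht : Odd t) (harc : A (x 0) (x 1)) :
    outDeg A (x 0) ≤ (t + 1) / 2 := by
  obtain ⟨hinj, hdir⟩ := hx
  have htpos : 0 < t := ht.pos
  have hfwd : ∀ i : Fin t, if i.val % 2 = 0 then A (x i.castSucc) (x i.succ)
      else A (x i.succ) (x i.castSucc) := by
    refine hdir.resolve_right fun h => ?_
    obtain ⟨s, rfl⟩ : ∃ s, t = s + 1 := ⟨t - 1, by omega⟩
    exact hA.2 _ _ harc (by simpa using h 0)
  classical
  let f : ℕ → V := fun k => x (Fin.ofNat (t + 1) (if k = 0 then 1 else 2 * k))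
  have hsub : {u | A (x 0) u} ⊆ ((Finset.range ((t + 1) / 2)).image f : Set V) := by
    intro u hu
    have hu' : u ∈ Set.range x := by
      by_contra h
      have := hmax _ (hasAntipath_succ_of_forward hinj hfwd hu h)
      omega
    obtain ⟨⟨i, hi⟩, rfl⟩ := hu'
    have hi0 : i ≠ 0 := by
      rintro rfl
      exact hA.1 _ hu
    obtain ⟨m, hm⟩ := ht
    have hmem : ∃ k < (t + 1) / 2, (if k = 0 then 1 else 2 * k) = i := by
      rcases Nat.mod_two_eq_zero_or_one i with hp | hp
      · exact ⟨i / 2, by omega, by rw [if_neg (by omega)]; omega⟩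
      · refine ⟨0, by omega, ?_⟩
        by_contra h1
        rw [if_pos rfl] at h1
        exact hnc ⟨_, hasAnticycle_of_forward_of_arc hinj hfwd hi hp (by omega) hu⟩
    obtain ⟨k, hk, hki⟩ := hmem
    refine Finset.mem_coe.2 (Finset.mem_image.2 ⟨k, Finset.mem_range.2 hk, ?_⟩)
    simp only [f, hki]
    exact congrArg x (Fin.ext (Nat.mod_eq_of_lt hi))
  calc outDeg A (x 0) ≤ ((Finset.range ((t + 1) / 2)).image f : Set V).ncard :=
        Set.ncard_le_ncard hsub (Finset.finite_toSet _)
    _ = ((Finset.range ((t + 1) / 2)).image f).card := Set.ncard_coe_finset _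
    _ ≤ (t + 1) / 2 := Finset.card_image_le.trans_eq (Finset.card_range _)
end

section
/- Let D be a finite oriented graph containing no anti-directed cycle, and let P = x₀x₁⋯x_t be an anti-directed path in D of maximum length among all anti-directed paths in D, with the arc between x₀ and x₁ oriented from x₀ to x₁. If t is even and there is no arc from x₀ to x_t, then the out-degree of x₀ satisfies d⁺(x₀) ≤ t/2. -/
/-- A vertex dominated by the source end of an antipath can be prepended to it. -/
theorem HasAntipath.of_cons {V : Type*} {A : V → V → Prop} {t : ℕ} {x : Fin (t + 1) → V}
    (hinj : Function.Injective x)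
    (hx : ∀ i : Fin t, if i.val % 2 = 0 then A (x i.castSucc) (x i.succ)
      else A (x i.succ) (x i.castSucc))
    {y : V} (hy : A (x 0) y) (hmem : y ∉ Set.range x) : HasAntipath A (t + 1) := by
  refine ⟨Fin.cons y x, Fin.cons_injective_iff.mpr ⟨hmem, hinj⟩, Or.inr fun i => ?_⟩
  induction i using Fin.cases with
  | zero => simpa using hy
  | succ j =>
    have h := hx j
    rw [Fin.cons_succ, ← Fin.succ_castSucc, Fin.cons_succ, Fin.val_succ]
    split_ifs at h ⊢ with h1 h2
    · omega
    · exact h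
    · exact h
    · omega

/-- An arc from the source end of an antipath to a later vertex at odd distance at least three
closes an anticycle. -/
theorem HasAnticycle.of_chord {V : Type*} {A : V → V → Prop} {X : ℕ → V} {n : ℕ}
    (hn : 3 ≤ n) (hodd : n % 2 = 1) (hinj : Set.InjOn X (Set.Iic n))
    (hX : ∀ i < n, if i % 2 = 0 then A (X i) (X (i + 1)) else A (X (i + 1)) (X i))
    (hchord : A (X 0) (X n)) : HasAnticycle A (n + 1) := by
  refine ⟨by omega, fun j : Fin (n + 1) => X j.val, fun a b hab => ?_, fun j => ?_⟩
  · exact Fin.ext (hinj (Nat.lt_succ_iff.mp (Fin.is_lt (n := n + 1) a))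
      (Nat.lt_succ_iff.mp (Fin.is_lt (n := n + 1) b)) hab)
  · have key : ∀ j : Fin (n + 1),
        (A (X j.val) (X (j + 1).val) ∧ A (X j.val) (X (j - 1).val)) ∨
        (A (X (j + 1).val) (X j.val) ∧ A (X (j - 1).val) (X j.val)) := by
      intro j
      obtain ⟨m, hm⟩ := j
      rw [Fin.val_add_one, Fin.coe_sub_one]
      simp only [Fin.ext_iff, Fin.val_last, Fin.val_zero]
      rcases Nat.eq_zero_or_pos m with rfl | hpos
      · have h := hX 0 (by omega)
        simp only [Nat.zero_mod, if_true] at h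
        left
        simpa [show ¬ 0 = n by omega] using ⟨h, hchord⟩
      · obtain ⟨k, rfl⟩ : ∃ k, m = k + 1 := ⟨m - 1, by omega⟩
        have h1 := hX k (by omega)
        by_cases hlast : k + 1 = n
        · right
          rw [if_pos (by omega)] at h1
          simp only [hlast, if_true, show ¬ n = 0 by omega, if_false,
            show n - 1 = k by omega]
          exact ⟨hchord, hlast ▸ h1⟩
        · have h2 := hX (k + 1) (by omega)
          simp only [hlast, if_false, Nat.add_one_ne_zero, Nat.add_sub_cancel]
          by_cases hk : k % 2 = 0
          · right
            rw [if_pos hk] at h1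
            rw [if_neg (by omega)] at h2
            exact ⟨h2, h1⟩
          · left
            rw [if_neg hk] at h1
            rw [if_pos (by omega)] at h2
            exact ⟨h2, h1⟩
    exact key j

/-- Let `D` be a finite oriented graph with no anti-directed cycle, and let
`P = x 0, x 1, …, x t` be a longest anti-directed path in `D`, with the arc between
`x 0` and `x 1` oriented from `x 0` to `x 1`.  If `t` is even and there is no arc
from `x 0` to `x t`, then `d⁺(x 0) ≤ t / 2`. -/
theorem outDeg_le_of_longest_antipath_even
    {V : Type*} [Fintype V] (A : V → V → Prop) (hA : IsOriented A)
    (hnc : ¬ ∃ ℓ, HasAnticycle A ℓ)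
    {t : ℕ} (x : Fin (t + 1) → V) (hx : IsAntipath A x)
    (hmax : ∀ m, HasAntipath A m → m ≤ t)
    (ht : Even t) (harc : A (x 0) (x 1)) (hlast : ¬ A (x 0) (x (Fin.last t))) :
    outDeg A (x 0) ≤ t / 2 := by
  classical
  obtain ⟨hinj, hx⟩ := hx
  have ht0 : 0 < t := by
    rcases Nat.eq_zero_or_pos t with rfl | h
    · exact absurd harc (hA.1 _)
    · exact h
  have hone : ((1 : Fin (t + 1)) : ℕ) = 1 := by
    rw [Fin.val_one', Nat.mod_eq_of_lt (by omega)]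
  replace hx : ∀ i : Fin t, if i.val % 2 = 0 then A (x i.castSucc) (x i.succ)
      else A (x i.succ) (x i.castSucc) := by
    refine hx.resolve_right fun h => hA.2 _ _ harc ?_
    have h0 := h ⟨0, ht0⟩
    have e : (⟨0, ht0⟩ : Fin t).succ = 1 := Fin.ext hone.symm
    rw [e] at h0
    simpa using h0
  let X : ℕ → V := fun n => x (Fin.ofNat (t + 1) n)
  have hXval : ∀ i : Fin (t + 1), X i = x i := fun i => by simp [X]
  have hXinj : Set.InjOn X (Set.Iic t) := by
    intro a ha b hb hab
    have h := congrArg Fin.val (hinj hab)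
    simpa [Fin.ofNat, Nat.mod_eq_of_lt (Nat.lt_succ_of_le ha),
      Nat.mod_eq_of_lt (Nat.lt_succ_of_le hb)] using h
  have hXarc : ∀ i < t, if i % 2 = 0 then A (X i) (X (i + 1)) else A (X (i + 1)) (X i) := by
    intro i hi
    have h := hx ⟨i, hi⟩
    rwa [← hXval, ← hXval] at h
  have hsub : {u | A (x 0) u} ⊆
      ((Finset.range (t / 2)).image fun k => if k = 0 then X 1 else X (2 * k) : Finset V) := by
    intro u hu
    by_cases hmem : u ∈ Set.range x
    · obtain ⟨i, rfl⟩ := hmem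
      have hu : A (x 0) (x i) := hu
      have hit := i.is_lt
      have hi0 : i.val ≠ 0 := fun h => hA.1 (x 0) (by
        rwa [show i = 0 from Fin.ext h] at hu)
      have hil : i.val ≠ t := fun h => hlast (by
        rwa [show i = Fin.last t from Fin.ext h] at hu)
      obtain ⟨s, hs⟩ := ht
      simp only [Finset.coe_image, Set.mem_image, Finset.coe_range, Set.mem_Iio]
      rcases Nat.mod_two_eq_zero_or_one i.val with hi | hi
      · refine ⟨i.val / 2, by omega, ?_⟩
        rw [if_neg (by omega), show 2 * (i.val / 2) = i.val by omega, hXval]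
      · have hi1 : i.val = 1 := by
          by_contra hne
          refine hnc ⟨_, HasAnticycle.of_chord (X := X) (n := i.val) (by omega) hi
            (hXinj.mono (Set.Iic_subset_Iic.mpr (by omega)))
            (fun k hk => hXarc k (by omega)) ?_⟩
          rw [hXval]
          simpa [X] using hu
        refine ⟨0, by omega, ?_⟩
        rw [if_pos rfl, ← hXval i, hi1]
    · exact absurd (hmax _ (HasAntipath.of_cons hinj hx hu hmem)) (by omega)
  calc outDeg A (x 0)
      ≤ _ := Set.ncard_le_ncard hsub (Finset.finite_toSet _)
    _ = _ := Set.ncard_coe_finset _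
    _ ≤ _ := Finset.card_image_le
    _ = t / 2 := Finset.card_range _
end

section
/- Let D be a finite oriented graph and let C = y₁y₂⋯y_sy₁ be an anti-directed cycle of length s in D, labeled so that y_i dominates both y_{i−1} and y_{i+1} (indices modulo s) for every odd i. If D contains no anti-directed path of length s or more, then N⁺(y_i) ⊆ V(C) for every odd i ∈ {1,3,…,s−1} and N⁻(y_j) ⊆ V(C) for every even j ∈ {2,4,…,s}. -/
/-- Traversing a cycle of length `s` once from the vertex `u m`, preceded by a vertex `w` off the
cycle, visits no vertex twice. -/
theorem injective_cons_cyclic_shift {V : Type*} {s : ℕ} {u : ZMod s → V}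
    (hinj : Function.Injective u) {w : V} (hw : ∀ j, u j ≠ w) (m : ℕ) :
    Function.Injective
      (Fin.cons w (fun k : Fin s => u ((m + k.val : ℕ) : ZMod s)) : Fin (s + 1) → V) := by
  refine Fin.cons_injective_iff.2 ⟨fun ⟨k, hk⟩ => hw _ hk, fun a b hab => ?_⟩
  have h := hinj hab
  rw [ZMod.natCast_eq_natCast_iff] at h
  exact Fin.ext ((Nat.ModEq.add_left_cancel' m h).eq_of_lt_of_lt a.isLt b.isLt)

/-- Let `C = u 0, u 1, …, u (s-1)` (indices mod `s`) be an anti-directed cycle of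
length `s` in a finite oriented graph `D`, labelled so that `u i` dominates both of
its cyclic neighbours for every `i` of even index (these are the vertices `y₁, y₃, …`
of odd one-based index).  If `D` contains no anti-directed path of length `s` or more,
then all out-neighbours of the even-indexed vertices and all in-neighbours of the
odd-indexed vertices lie on `C`. -/
theorem anticycle_neighbors_subset
    {V : Type*} [Fintype V] (A : V → V → Prop) (hA : IsOriented A)
    (s : ℕ) (hs : 3 ≤ s) (hse : Even s)
    (u : ZMod s → V) (hinj : Function.Injective u)
    (hC : ∀ i : ZMod s, i.val % 2 = 0 → A (u i) (u (i + 1)) ∧ A (u i) (u (i - 1)))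
    (hpath : ∀ ℓ, HasAntipath A ℓ → ℓ < s) :
    (∀ i : ZMod s, i.val % 2 = 0 → ∀ w, A (u i) w → ∃ j, u j = w) ∧
    (∀ i : ZMod s, i.val % 2 = 1 → ∀ w, A w (u i) → ∃ j, u j = w) := by
  have : NeZero s := ⟨by omega⟩
  have hdvd : 2 ∣ s := hse.two_dvd
  have hval (n : ℕ) : ((n : ZMod s)).val % 2 = n % 2 := by
    rw [ZMod.val_natCast, Nat.mod_mod_of_dvd _ hdvd]
  have hE (n : ℕ) (hn : n % 2 = 0) : A (u (n : ℕ)) (u (n + 1 : ℕ)) := by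
    simpa using (hC n (by rw [hval, hn])).1
  have hO (n : ℕ) (hn : n % 2 = 1) : A (u (n + 1 : ℕ)) (u (n : ℕ)) := by
    simpa using (hC (n + 1 : ℕ) (by rw [hval]; omega)).2
  refine ⟨fun i hi w hw => ?_, fun i hi w hw => ?_⟩ <;> by_contra! hoff <;>
    refine (hpath s ⟨_, injective_cons_cyclic_shift hinj hoff i.val, ?_⟩).false
  · refine Or.inr fun k => ?_
    obtain ⟨k, hk⟩ := k
    rcases k with _ | k
    · obtain ⟨s, rfl⟩ : ∃ t, s = t + 1 := ⟨s - 1, by omega⟩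
      simpa using hw
    · change if (k + 1) % 2 = 0 then A (u (i.val + (k + 1) : ℕ)) (u (i.val + k : ℕ))
        else A (u (i.val + k : ℕ)) (u (i.val + (k + 1) : ℕ))
      split_ifs with h
      · exact hO (i.val + k) (by omega)
      · exact hE (i.val + k) (by omega)
  · refine Or.inl fun k => ?_
    obtain ⟨k, hk⟩ := k
    rcases k with _ | k
    · obtain ⟨s, rfl⟩ : ∃ t, s = t + 1 := ⟨s - 1, by omega⟩
      simpa using hw
    · change if (k + 1) % 2 = 0 then A (u (i.val + k : ℕ)) (u (i.val + (k + 1) : ℕ))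
        else A (u (i.val + (k + 1) : ℕ)) (u (i.val + k : ℕ))
      split_ifs with h
      · exact hE (i.val + k) (by omega)
      · exact hO (i.val + k) (by omega)
end

section
/- Let D be a finite oriented graph and let Q = z₀z₁⋯z_t be an anti-directed path in D of maximum length among all anti-directed paths in D, with t even and the arc between z₀ and z₁ oriented from z₀ to z₁. If there is an arc from z₀ to z_t, then N⁺(z_t) ∪ N⁻(z_t) ⊆ V(Q); in particular, t ≥ d⁺(z_t) + d⁻(z_t). -/
/-- Rotating an antipath `z 0 → z 1 ← ⋯ ← z t`, with `z 0 → z t`, and prepending an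
in-neighbour `w` of `z t` gives the antipath `w → z t ← z 0 → z 1 ← ⋯` of length `t + 1`. -/
lemma isAntipath_cons_cons_last {V : Type*} {A : V → V → Prop} {t : ℕ} {z : Fin (t + 1) → V}
    (hinj : Function.Injective z)
    (hz : ∀ i : Fin t, if i.val % 2 = 0 then A (z i.castSucc) (z i.succ)
        else A (z i.succ) (z i.castSucc))
    (ht : 0 < t) (h0t : A (z 0) (z (Fin.last t))) {w : V} (hw : ∀ i, z i ≠ w)
    (hwA : A w (z (Fin.last t))) :
    IsAntipath A (Fin.cons w (Fin.cons (z (Fin.last t)) fun i : Fin t => z i.castSucc) :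
      Fin (t + 1 + 1) → V) := by
  obtain ⟨s, rfl⟩ : ∃ s, t = s + 1 := ⟨t - 1, by omega⟩
  refine ⟨?_, Or.inl fun i => ?_⟩
  · rw [Fin.cons_injective_iff, Fin.cons_injective_iff]
    refine ⟨?_, ?_, hinj.comp (Fin.castSucc_injective _)⟩
    · rintro ⟨j, hj⟩
      cases j using Fin.cases with
      | zero => exact hw _ hj
      | succ j => exact hw _ hj
    · rintro ⟨j, hj⟩
      exact (Fin.castSucc_lt_last j).ne (hinj hj)
  · cases i using Fin.cases with
    | zero => simpa using hwA
    | succ i =>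
      cases i using Fin.cases with
      | zero =>
        rw [if_neg (by simp)]
        exact h0t
      | succ i =>
        have h := hz i.castSucc
        have hmod : (i.val + 1 + 1) % 2 = i.val % 2 := by omega
        simpa [← Fin.succ_castSucc, hmod] using h

/-- An antipath `z 0 → z 1 ← ⋯ ← z t` with `t` even extends by an out-neighbour of `z t`. -/
lemma isAntipath_snoc {V : Type*} {A : V → V → Prop} {t : ℕ} {z : Fin (t + 1) → V}
    (hinj : Function.Injective z)
    (hz : ∀ i : Fin t, if i.val % 2 = 0 then A (z i.castSucc) (z i.succ)
        else A (z i.succ) (z i.castSucc))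
    (ht : Even t) {w : V} (hw : ∀ i, z i ≠ w) (hwA : A (z (Fin.last t)) w) :
    IsAntipath A (Fin.snoc z w : Fin (t + 1 + 1) → V) := by
  refine ⟨?_, Or.inl fun i => ?_⟩
  · rw [Fin.snoc_injective_iff]
    exact ⟨hinj, fun ⟨j, hj⟩ => hw j hj⟩
  · cases i using Fin.lastCases with
    | last =>
      rw [Fin.snoc_castSucc, Fin.succ_last, Fin.snoc_last]
      simpa [Nat.even_iff.mp ht] using hwA
    | cast i =>
      rw [Fin.snoc_castSucc, Fin.succ_castSucc, Fin.snoc_castSucc]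
      exact hz i

/-- In an oriented graph, if all neighbours of a vertex `z j` lie in the range of
`z : Fin (t + 1) → V`, then the total degree of `z j` is at most `t`. -/
lemma outDeg_add_inDeg_le {V : Type*} [Finite V] {A : V → V → Prop} (hA : IsOriented A)
    {t : ℕ} (z : Fin (t + 1) → V) (j : Fin (t + 1))
    (h : ∀ w, A (z j) w ∨ A w (z j) → ∃ i, z i = w) :
    outDeg A (z j) + inDeg A (z j) ≤ t := by
  have hdisj : Disjoint {u | A (z j) u} {u | A u (z j)} :=
    Set.disjoint_left.mpr fun u h₁ h₂ => hA.2 _ _ h₁ h₂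
  have hsub : {u | A (z j) u} ∪ {u | A u (z j)} ⊆ z '' {j}ᶜ := by
    intro u hu
    obtain ⟨i, rfl⟩ := h u hu
    refine ⟨i, ?_, rfl⟩
    rintro rfl
    exact hu.elim (hA.1 _) (hA.1 _)
  calc outDeg A (z j) + inDeg A (z j)
      = ({u | A (z j) u} ∪ {u | A u (z j)}).ncard := (Set.ncard_union_eq hdisj).symm
    _ ≤ (z '' {j}ᶜ).ncard := Set.ncard_le_ncard hsub
    _ ≤ ({j}ᶜ : Set (Fin (t + 1))).ncard := Set.ncard_image_le
    _ = t := by rw [Set.ncard_compl, Set.ncard_singleton, Nat.card_fin, Nat.add_sub_cancel]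

/-- Let `Q = z 0, z 1, …, z t` be a longest anti-directed path in a finite oriented
graph `D`, with `t` even and the arc between `z 0` and `z 1` oriented from `z 0` to
`z 1`.  If there is an arc from `z 0` to `z t`, then all out- and in-neighbours of
`z t` lie on `Q`; in particular `t ≥ d⁺(z t) + d⁻(z t)`. -/
theorem neighbors_subset_of_longest_antipath_even
    {V : Type*} [Fintype V] (A : V → V → Prop) (hA : IsOriented A)
    {t : ℕ} (z : Fin (t + 1) → V) (hz : IsAntipath A z)
    (hmax : ∀ m, HasAntipath A m → m ≤ t)
    (ht : Even t) (h01 : A (z 0) (z 1)) (h0t : A (z 0) (z (Fin.last t))) :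
    (∀ w, A (z (Fin.last t)) w ∨ A w (z (Fin.last t)) → ∃ i, z i = w) ∧
    outDeg A (z (Fin.last t)) + inDeg A (z (Fin.last t)) ≤ t := by
  have ht0 : 0 < t := by
    rcases Nat.eq_zero_or_pos t with rfl | h
    · exact absurd h01 (hA.1 _)
    · exact h
  obtain ⟨hinj, hor⟩ := hz
  have hz' : ∀ i : Fin t, if i.val % 2 = 0 then A (z i.castSucc) (z i.succ)
      else A (z i.succ) (z i.castSucc) := by
    refine hor.resolve_right fun h => ?_
    obtain ⟨s, rfl⟩ : ∃ s, t = s + 1 := ⟨t - 1, by omega⟩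
    exact hA.2 _ _ h01 (by simpa using h 0)
  have hmem : ∀ w, A (z (Fin.last t)) w ∨ A w (z (Fin.last t)) → ∃ i, z i = w := by
    intro w hw
    by_contra! hne
    refine absurd (hmax (t + 1) ?_) (by omega)
    rcases hw with hw | hw
    · exact ⟨_, isAntipath_snoc hinj hz' ht hne hw⟩
    · exact ⟨_, isAntipath_cons_cons_last hinj hz' ht0 h0t hne hw⟩
  exact ⟨hmem, outDeg_add_inDeg_le hA z _ hmem⟩
end
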